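/- (Corollary 4.6, random Perron–Frobenius theorem) Let A = {A_ω} be a summable random matrix with the b.i.p.-property. Then there exist a positive random variable λ: Ω → ℝ and strictly positive random vectors h = {h^ω ∈ ℝ^{ℓ_ω−1}} and μ = {μ^ω ∈ ℝ^{ℓ_ω−1}} such that for a.e. ω: (h^ω)^t A^ω = λ(ω) h^{θω}, A^ω μ^{θω} = λ(ω) μ^ω, and (h^ω)^t μ^ω = 1. Furthermore, with Λ_n(ω)=λ(ω)⋯λ(θ^{n−1}ω), for a.e. ω and every i < ℓ_ω: lim_{n→∞} Σ_{j<ℓ_{θ^nω}} | (A^ω A^{θω} ⋯ A^{θ^{n−1}ω})_{ij} / Λ_n(ω) − μ^ω_i h^{θ^nω}_j | μ^{θ^nω}_j = 0. -/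

import Mathlib

open MeasureTheory Filter Topology
open scoped Classical

noncomputable section

namespace RandomTMC

/-- A random countable topological Markov chain over an invertible base
transformation `θ` of `Ω`.  The alphabet availability `letterOK ω i` plays the
role of "`i < ℓ_ω`", and `tr ω i j` is the 0–1 transition matrix `α_{ij}(ω)`. -/
structure Chain (Ω : Type*) [MeasurableSpace Ω] where
  θ : Ω → Ω
  θinv : Ω → Ω
  θ_meas : Measurable θ
  θinv_meas : Measurable θinv
  θ_left_inv : Function.LeftInverse θinv θ
  θ_right_inv : Function.RightInverse θinv θ
  letterOK : Ω → ℕ → Bool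
  letterOK_meas : ∀ i, Measurable fun ω => letterOK ω i
  two_letters : ∀ ω, ∃ i j, i ≠ j ∧ letterOK ω i = true ∧ letterOK ω j = true
  tr : Ω → ℕ → ℕ → Bool
  tr_meas : ∀ i j, Measurable fun ω => tr ω i j
  no_zero_row : ∀ ω i, letterOK ω i = true → ∃ j, letterOK (θ ω) j = true ∧ tr ω i j = true

variable {Ω : Type*} [MeasurableSpace Ω]

/-- The fiber `X_ω ⊆ ℕ^ℕ`. -/
def fiber (S : Chain Ω) (ω : Ω) : Set (ℕ → ℕ) :=
  {x | ∀ n : ℕ, S.letterOK (S.θ^[n] ω) (x n) = true ∧ S.tr (S.θ^[n] ω) (x n) (x (n + 1)) = true}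

/-- The shift map `T_ω`. -/
def shift (x : ℕ → ℕ) : ℕ → ℕ := fun n => x (n + 1)

/-- The iterated shift `T^n_ω`. -/
def shiftIt (n : ℕ) (x : ℕ → ℕ) : ℕ → ℕ := fun k => x (k + n)

/-- `w` is an `ω`-admissible word. -/
def wordAdm (S : Chain Ω) (ω : Ω) (w : List ℕ) : Prop :=
  (∀ (i : ℕ) (h : i < w.length), S.letterOK (S.θ^[i] ω) (w.get ⟨i, h⟩) = true) ∧
  (∀ (i : ℕ) (h : i + 1 < w.length),
    S.tr (S.θ^[i] ω) (w.get ⟨i, Nat.lt_of_succ_lt h⟩) (w.get ⟨i + 1, h⟩) = true)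

/-- The cylinder set `[w]_ω`. -/
def cyl (S : Chain Ω) (ω : Ω) (w : List ℕ) : Set (ℕ → ℕ) :=
  {x | x ∈ fiber S ω ∧ ∀ (i : ℕ) (h : i < w.length), x i = w.get ⟨i, h⟩}

/-- `Ω_w = {ω : [w]_ω ≠ ∅}`. -/
def OmegaW (S : Chain Ω) (w : List ℕ) : Set Ω := {ω | (cyl S ω w).Nonempty}

/-- The Birkhoff sum `φ^ω_n(x)`. -/
def birk (S : Chain Ω) (φ : Ω → (ℕ → ℕ) → ℝ) (ω : Ω) (n : ℕ) (x : ℕ → ℕ) : ℝ :=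
  ∑ j ∈ Finset.range n, φ (S.θ^[j] ω) (shiftIt j x)

/-- Prepend a finite word to a sequence. -/
def prepend (w : List ℕ) (x : ℕ → ℕ) : ℕ → ℕ := fun n =>
  if h : n < w.length then w.get ⟨n, h⟩ else x (n - w.length)

/-- The iterated Ruelle transfer operator `L^{ω,n}_φ f (x)`. -/
def ruelleIt (S : Chain Ω) (φ : Ω → (ℕ → ℕ) → ℝ) (ω : Ω) (n : ℕ)
    (f : (ℕ → ℕ) → ℝ) (x : ℕ → ℕ) : ℝ :=
  ∑' w : List ℕ,
    if w.length = n ∧ prepend w x ∈ fiber S ω then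
      Real.exp (birk S φ ω n (prepend w x)) * f (prepend w x)
    else 0

/-- `M_ω = sup L^ω_φ(1)`. -/
def Mfun (S : Chain Ω) (φ : Ω → (ℕ → ℕ) → ℝ) (ω : Ω) : ℝ :=
  sSup ((fun x => ruelleIt S φ ω 1 (fun _ => (1 : ℝ)) x) '' fiber S (S.θ ω))

/-- `m_ω = inf L^ω_φ(1)`. -/
def mfun (S : Chain Ω) (φ : Ω → (ℕ → ℕ) → ℝ) (ω : Ω) : ℝ :=
  sInf ((fun x => ruelleIt S φ ω 1 (fun _ => (1 : ℝ)) x) '' fiber S (S.θ ω))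

/-- `B_ω = exp (∑_{k ≥ 1} κ(θ^{-k} ω) r^k)`. -/
def Bconst (S : Chain Ω) (κ : Ω → ℝ) (r : ℝ) (ω : Ω) : ℝ :=
  Real.exp (∑' k : ℕ, κ (S.θinv^[k + 1] ω) * r ^ (k + 1))

/-- `φ` is locally fiber Hölder continuous with index `k`, constants `κ, r`. -/
def HolderIdx (S : Chain Ω) (P : Measure Ω) (φ : Ω → (ℕ → ℕ) → ℝ)
    (κ : Ω → ℝ) (r : ℝ) (k : ℕ) : Prop :=
  0 < r ∧ r < 1 ∧ (∀ ω, 1 ≤ κ ω) ∧ Measurable κ ∧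
    Integrable (fun ω => Real.log (κ ω)) P ∧
    ∀ ω (n : ℕ), k ≤ n → ∀ x ∈ fiber S ω, ∀ y ∈ fiber S ω,
      (∀ i < n, x i = y i) → |φ ω x - φ ω y| ≤ κ ω * r ^ n

/-- `exp(φ^ω_n([w])) = sup {exp(φ^ω_n(x)) : x ∈ [w]_ω}`. -/
def supExp (S : Chain Ω) (φ : Ω → (ℕ → ℕ) → ℝ) (ω : Ω) (n : ℕ) (w : List ℕ) : ℝ :=
  sSup ((fun x => Real.exp (birk S φ ω n x)) '' cyl S ω w)

/-- The Gurevič partition function `Z^ω_n(a)`. -/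
def Zfun (S : Chain Ω) (φ : Ω → (ℕ → ℕ) → ℝ) (a : ℕ) (ω : Ω) (n : ℕ) : ℝ :=
  ∑' w : List ℕ,
    if w.length = n ∧ w.head? = some a ∧ wordAdm S ω (w ++ [a]) then
      supExp S φ ω n (w ++ [a])
    else 0

/-- `A^ω_n = ∑_{w ∈ W^n_ω} e^{φ^ω_n([w])}`. -/
def Afun (S : Chain Ω) (φ : Ω → (ℕ → ℕ) → ℝ) (ω : Ω) (n : ℕ) : ℝ :=
  ∑' w : List ℕ, if w.length = n ∧ wordAdm S ω w then supExp S φ ω n w else 0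

/-- The local preimage function `𝒵^ω_n(a) = L^{ω,n}_φ(1_{[a]})(ξ_{θ^n ω})`. -/
def locPre (S : Chain Ω) (φ : Ω → (ℕ → ℕ) → ℝ) (a : ℕ) (ξ : Ω → ℕ → ℕ) (ω : Ω) (n : ℕ) : ℝ :=
  ruelleIt S φ ω n (Set.indicator (cyl S ω [a]) fun _ => (1 : ℝ)) (ξ (S.θ^[n] ω))

/-- The preimage function `𝒵^ω_n = L^{ω,n}_φ(1)(ξ_{θ^n ω})`. -/
def preFun (S : Chain Ω) (φ : Ω → (ℕ → ℕ) → ℝ) (ξ : Ω → ℕ → ℕ) (ω : Ω) (n : ℕ) : ℝ :=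
  ruelleIt S φ ω n (fun _ => (1 : ℝ)) (ξ (S.θ^[n] ω))

/-- The mixing property for the pair `(a, b)` with mixing time `N = N_{ab}`. -/
def MixPair (S : Chain Ω) (a b : ℕ) (N : Ω → ℕ) : Prop :=
  ∀ ω (n : ℕ), N ω ≤ n → wordAdm S ω [a] → S.θ^[n] ω ∈ OmegaW S [b] →
    ∃ x ∈ cyl S ω [a], shiftIt n x ∈ cyl S (S.θ^[n] ω) [b]

/-- `(X, T)` is topologically mixing. -/
def TopMix (S : Chain Ω) (P : Measure Ω) : Prop :=
  ∀ a b : ℕ, 0 < P (OmegaW S [a]) → 0 < P (OmegaW S [b]) →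
    ∃ N : Ω → ℕ, Measurable N ∧ MixPair S a b N

/-- The big image property with base set `Ωbi`. -/
def BigIm (S : Chain Ω) (P : Measure Ω) (Ωbi : Set Ω) : Prop :=
  0 < P Ωbi ∧ ∀ ω ∈ Ωbi, ∃ I : Finset ℕ,
    (∀ b ∈ I, wordAdm S ω [b]) ∧
    ∀ a : ℕ, wordAdm S (S.θinv ω) [a] → ∃ b ∈ I, wordAdm S (S.θinv ω) [a, b]

/-- The big preimage property with base set `Ωbp`. -/
def BigPre (S : Chain Ω) (P : Measure Ω) (Ωbp : Set Ω) : Prop :=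
  0 < P Ωbp ∧ ∀ ω ∈ Ωbp, ∃ I : Finset ℕ,
    (∀ b ∈ I, wordAdm S (S.θinv ω) [b]) ∧
    ∀ a : ℕ, wordAdm S ω [a] → ∃ b ∈ I, wordAdm S (S.θinv ω) [b, a]

/-- Nonemptiness of `W^n_ω(a, b)`. -/
def WSetNe (S : Chain Ω) (ω : Ω) (n : ℕ) (a b : ℕ) : Prop :=
  ∃ w : List ℕ, w.length = n ∧ w.head? = some a ∧ wordAdm S ω (w ++ [b])

/-- The terms of the random power series `P_ω(s)`. -/
def PserTerm (S : Chain Ω) (φ : Ω → (ℕ → ℕ) → ℝ) (ξ : Ω → ℕ → ℕ)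
    (Ωt : Set Ω) (ω : Ω) (s : ℝ) : ℕ → ℝ := fun n =>
  if S.θ^[n] ω ∈ Ωt then s ^ n * preFun S φ ξ ω n else 0

/-- The random power series `P_ω(s) = ∑_{n ∈ J_ω(Ω̃)} s^n 𝒵^ω_n`. -/
def Pser (S : Chain Ω) (φ : Ω → (ℕ → ℕ) → ℝ) (ξ : Ω → ℕ → ℕ)
    (Ωt : Set Ω) (ω : Ω) (s : ℝ) : ℝ :=
  ∑' n : ℕ, PserTerm S φ ξ Ωt ω s n

/-- `(X, T, φ)` is of divergence type with witness set `Ω̃ = Ωt ⊆ Ω_a`. -/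
def DivType (S : Chain Ω) (P : Measure Ω) (φ : Ω → (ℕ → ℕ) → ℝ) (ξ : Ω → ℕ → ℕ)
    (a : ℕ) (Ωt : Set Ω) : Prop :=
  Ωt ⊆ OmegaW S [a] ∧
    (∀ᵐ ω ∂P, ∀ s : ℝ, 0 < s → s < 1 → Summable (PserTerm S φ ξ Ωt ω s)) ∧
    (∀ᵐ ω ∂P, ¬ Summable (PserTerm S φ ξ Ωt ω 1))

/-- The random measure `μ_{ω,s}`. -/
def muMeas (S : Chain Ω) (φ : Ω → (ℕ → ℕ) → ℝ) (ξ : Ω → ℕ → ℕ)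
    (Ωt : Set Ω) (ω : Ω) (s : ℝ) : Measure (ℕ → ℕ) :=
  (ENNReal.ofReal (Pser S φ ξ Ωt ω s))⁻¹ •
    Measure.sum fun q : ℕ × List ℕ =>
      if S.θ^[q.1] ω ∈ Ωt ∧ q.2.length = q.1 ∧ prepend q.2 (ξ (S.θ^[q.1] ω)) ∈ fiber S ω then
        ENNReal.ofReal (s ^ q.1 * Real.exp (birk S φ ω q.1 (prepend q.2 (ξ (S.θ^[q.1] ω))))) •
          Measure.dirac (prepend q.2 (ξ (S.θ^[q.1] ω)))
      else 0

/-- `Λ_n(ω) = λ(ω) λ(θω) ⋯ λ(θ^{n-1}ω)`. -/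
def Lam (S : Chain Ω) (lam : Ω → ℝ) (ω : Ω) (n : ℕ) : ℝ :=
  ∏ j ∈ Finset.range n, lam (S.θ^[j] ω)

/-- The matrix product `(A^ω A^{θω} ⋯ A^{θ^{n-1}ω})_{ij}`. -/
def matProd (S : Chain Ω) (p : Ω → ℕ → ℕ → ℝ) (ω : Ω) : ℕ → ℕ → ℕ → ℝ
  | 0 => fun i j => if i = j then 1 else 0
  | n + 1 => fun i j => ∑' k : ℕ, matProd S p ω n i k * p (S.θ^[n] ω) k j

/-- The iterated matrix-vector product `(A^{θ^{-n}ω} ⋯ A^{θ^{-1}ω} f)_j`, where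
`S.θ` is the inverse `θ^{-1}` of the base map of the original system. -/
def matVecIt (S : Chain Ω) (p : Ω → ℕ → ℕ → ℝ) (ω : Ω) (f : ℕ → ℝ) : ℕ → ℕ → ℝ
  | 0 => f
  | n + 1 => fun j => ∑' i : ℕ, p (S.θ^[n + 1] ω) j i * matVecIt S p ω f n i


/-- The product of two `[0, ∞]`-valued matrices indexed by `ℕ`. -/
def mm (A B : ℕ → ℕ → ENNReal) : ℕ → ℕ → ENNReal := fun i j => ∑' k, A i k * B k j

theorem mm_assoc (A B C : ℕ → ℕ → ENNReal) : mm (mm A B) C = mm A (mm B C) := by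
  funext i j
  simp only [mm, ← ENNReal.tsum_mul_left, ← ENNReal.tsum_mul_right]
  rw [ENNReal.tsum_comm]
  simp only [mul_assoc]

theorem mm_swap (A B : ℕ → ℕ → ENNReal) :
    Function.swap (mm A B) = mm (Function.swap B) (Function.swap A) := by
  funext i j
  simp only [mm, Function.swap, mul_comm]

/-- All `2 × 2` cross ratios of the matrix `E` are bounded by `κ`. -/
def CrossRatioLE (κ : ENNReal) (E : ℕ → ℕ → ENNReal) : Prop :=
  ∀ i j k l, E i j * E k l ≤ κ * (E i l * E k j)

theorem CrossRatioLE.mono {κ κ' : ENNReal} (h : κ ≤ κ') {E : ℕ → ℕ → ENNReal}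
    (hE : CrossRatioLE κ E) : CrossRatioLE κ' E := fun i j k l =>
  (hE i j k l).trans (by gcongr)

theorem CrossRatioLE.swap {κ : ENNReal} {E : ℕ → ℕ → ENNReal} (hE : CrossRatioLE κ E) :
    CrossRatioLE κ (Function.swap E) := by
  intro i j k l
  have := hE j i l k
  simp only [Function.swap]
  rwa [mul_comm (E l i)]

theorem CrossRatioLE.mm_right {κ : ENNReal} {E : ℕ → ℕ → ENNReal} (hE : CrossRatioLE κ E)
    (G : ℕ → ℕ → ENNReal) : CrossRatioLE κ (mm E G) := by
  intro i j k l
  simp only [mm, ← ENNReal.tsum_mul_left, ← ENNReal.tsum_mul_right]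
  rw [ENNReal.tsum_comm]
  nth_rw 2 [ENNReal.tsum_comm]
  rw [ENNReal.tsum_comm]
  refine ENNReal.tsum_le_tsum fun a => ENNReal.tsum_le_tsum fun b => ?_
  calc _ = (E i b * E k a) * (G b j * G a l) := by ring
    _ ≤ (κ * (E i a * E k b)) * (G b j * G a l) := mul_le_mul_left (hE _ _ _ _) _
    _ = _ := by ring

theorem CrossRatioLE.mm_left {κ : ENNReal} {E : ℕ → ℕ → ENNReal} (hE : CrossRatioLE κ E)
    (G : ℕ → ℕ → ENNReal) : CrossRatioLE κ (mm G E) := by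
  have := (hE.swap.mm_right (Function.swap G)).swap
  rwa [← mm_swap] at this

/-- The rearrangement inequality behind the contraction of cross ratios. -/
theorem pair_contraction_real {x y X Y ε q : ℝ} (hx : 0 ≤ x) (hy : 0 ≤ y) (hX : 0 ≤ X)
    (hY : 0 ≤ Y) (hε : 0 ≤ ε) (hq : 0 ≤ q)
    (h1 : x ≤ (1 + ε) * y) (h2 : y ≤ (1 + ε) * x) (h3 : X ≤ Y + q * X) (h4 : Y ≤ X + q * Y) :
    x * X + y * Y ≤ (1 + q * ε) * (y * X + x * Y) := by
  have key : (x - y) * (X - Y) ≤ q * ε * (y * X + x * Y) := by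
    have a1 : 0 ≤ q * ε * (y * X) := by positivity
    have a2 : 0 ≤ q * ε * (x * Y) := by positivity
    rcases le_total y x with h | h <;> rcases le_total Y X with h' | h'
    · have : (x - y) * (X - Y) ≤ (ε * y) * (q * X) :=
        mul_le_mul (by linarith) (by linarith) (by linarith) (by positivity)
      nlinarith
    · nlinarith [mul_nonneg (sub_nonneg.2 h) (sub_nonneg.2 h')]
    · nlinarith [mul_nonneg (sub_nonneg.2 h) (sub_nonneg.2 h')]
    · have : (y - x) * (Y - X) ≤ (ε * x) * (q * Y) :=
        mul_le_mul (by linarith) (by linarith) (by linarith) (by positivity)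
      nlinarith
  nlinarith

theorem pair_contraction {x y X Y ε D q : NNReal} (hD : D ≤ 1 + q * D)
    (h1 : x ≤ (1 + ε) * y) (h2 : y ≤ (1 + ε) * x) (h3 : X ≤ D * Y) (h4 : Y ≤ D * X) :
    x * X + y * Y ≤ (1 + q * ε) * (y * X + x * Y) := by
  have aux : ∀ X Y : NNReal, X ≤ D * Y → Y ≤ D * X → (X : ℝ) ≤ Y + q * X := by
    intro X Y h h'
    rw [← NNReal.coe_le_coe] at h h' hD
    push_cast at h h' hD
    by_contra! hlt
    have hq : (q : ℝ) < 1 := by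
      by_contra! hq
      nlinarith [X.2, Y.2, NNReal.coe_nonneg X, NNReal.coe_nonneg Y]
    have : (Y : ℝ) < (1 - q) * X := by linarith
    have hD' : (D : ℝ) * (1 - q) ≤ 1 := by linarith
    by_cases hD0 : (D : ℝ) = 0
    · rw [hD0] at h h'
      nlinarith [NNReal.coe_nonneg X, NNReal.coe_nonneg Y]
    have hDpos : 0 < (D : ℝ) := lt_of_le_of_ne D.2 (Ne.symm hD0)
    nlinarith [NNReal.coe_nonneg X, mul_lt_mul_of_pos_left this hDpos]
  rw [← NNReal.coe_le_coe]
  push_cast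
  refine pair_contraction_real x.2 y.2 X.2 Y.2 ε.2 q.2 ?_ ?_ (aux X Y h3 h4) (aux Y X h4 h3)
  · exact_mod_cast h1
  · exact_mod_cast h2

/-- Multiplication by a matrix with bounded cross ratios contracts cross ratios towards `1`. -/
theorem CrossRatioLE.contract {ε D q : NNReal} (hD : D ≤ 1 + q * D)
    {F E : ℕ → ℕ → ENNReal} (hF : CrossRatioLE (1 + ε) F) (hE : CrossRatioLE D E)
    (hFfin : ∀ i j, F i j ≠ ⊤) (hEfin : ∀ i j, E i j ≠ ⊤) :
    CrossRatioLE (1 + q * ε) (mm F E) := by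
  intro i j k l
  have expand : ∀ i j k l, mm F E i j * mm F E k l =
      ∑' a, ∑' b, (F i a * F k b) * (E a j * E b l) := by
    intro i j k l
    simp only [mm, ← ENNReal.tsum_mul_left, ← ENNReal.tsum_mul_right]
    rw [ENNReal.tsum_comm]
    exact tsum_congr fun a => tsum_congr fun b => by ring
  have pairing : ∀ a b : ℕ, (F i a * F k b) * (E a j * E b l) + (F i b * F k a) * (E b j * E a l)
      ≤ (1 + q * ε) * ((F i b * F k a) * (E a j * E b l) + (F i a * F k b) * (E b j * E a l)) := by
    intro a b
    have f1 := hF i a k b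
    have f2 := hF i b k a
    have e1 := hE a j b l
    have e2 := hE b j a l
    rw [mul_comm (E a l)] at e1
    rw [mul_comm (E b l)] at e2
    generalize hx : F i a * F k b = x at *
    generalize hy : F i b * F k a = y at *
    generalize hX : E a j * E b l = X at *
    generalize hY : E b j * E a l = Y at *
    lift x to NNReal using hx ▸ ENNReal.mul_ne_top (hFfin _ _) (hFfin _ _)
    lift y to NNReal using hy ▸ ENNReal.mul_ne_top (hFfin _ _) (hFfin _ _)
    lift X to NNReal using hX ▸ ENNReal.mul_ne_top (hEfin _ _) (hEfin _ _)
    lift Y to NNReal using hY ▸ ENNReal.mul_ne_top (hEfin _ _) (hEfin _ _)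
    norm_cast at *
    exact pair_contraction hD f1 f2 e1 e2
  have two : 2 * (mm F E i j * mm F E k l) ≤
      2 * ((1 + q * ε) * (mm F E i l * mm F E k j)) := by
    calc 2 * (mm F E i j * mm F E k l)
        = ∑' a, ∑' b, ((F i a * F k b) * (E a j * E b l) + (F i b * F k a) * (E b j * E a l)) := by
          simp only [ENNReal.tsum_add]
          rw [two_mul, ← expand, ENNReal.tsum_comm, ← expand]
      _ ≤ ∑' a, ∑' b, (1 + q * ε) *
          ((F i b * F k a) * (E a j * E b l) + (F i a * F k b) * (E b j * E a l)) :=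
          ENNReal.tsum_le_tsum fun a => ENNReal.tsum_le_tsum fun b => pairing a b
      _ = 2 * ((1 + q * ε) * (mm F E i l * mm F E k j)) := by
          simp only [ENNReal.tsum_mul_left, ENNReal.tsum_add]
          have h1 : ∑' a, ∑' b, (F i b * F k a) * (E a j * E b l) = mm F E i l * mm F E k j := by
            rw [expand, ENNReal.tsum_comm]
            exact tsum_congr fun a => tsum_congr fun b => by ring
          have h2 : ∑' a, ∑' b, (F i a * F k b) * (E b j * E a l) = mm F E i l * mm F E k j := by
            rw [expand]
            exact tsum_congr fun a => tsum_congr fun b => by ring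
          rw [h1, h2]
          ring
  exact (ENNReal.mul_le_mul_iff_right (by norm_num) (by norm_num)).1 two

/-- Later members of the sequence are obtained by multiplication on the right. -/
def Nested (F : ℕ → ℕ → ℕ → ENNReal) : Prop := ∀ n m, n ≤ m → ∃ G, F m = mm (F n) G

theorem eventually_crossRatioLE {F : ℕ → ℕ → ℕ → ENNReal} (hF : Nested F)
    (hfin : ∀ n i j, F n i j ≠ ⊤) {D : NNReal} (hD : 1 ≤ D)
    (hblock : ∀ N, ∃ n ≥ N, ∃ m, ∃ E, F m = mm (F n) E ∧ (∀ i j, E i j ≠ ⊤) ∧ CrossRatioLE D E)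
    {ε : ENNReal} (hε : ε ≠ 0) : ∀ᶠ n in atTop, CrossRatioLE (1 + ε) (F n) := by
  have hD0 : D ≠ 0 := (lt_of_lt_of_le one_pos hD).ne'
  set q : NNReal := (D - 1) / D with hq
  have hqD : D ≤ 1 + q * D := by
    rw [hq, div_mul_cancel₀ _ hD0, add_tsub_cancel_of_le hD]
  have hq1 : q < 1 := by
    rw [hq, div_lt_one (lt_of_lt_of_le one_pos hD)]
    exact tsub_lt_self (lt_of_lt_of_le one_pos hD) one_pos
  have step : ∀ N : ℕ, ∃ n, CrossRatioLE (1 + (q ^ N * D : NNReal)) (F n) := by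
    intro N
    induction N with
    | zero =>
      obtain ⟨n, -, m, E, hm, -, hE⟩ := hblock 0
      refine ⟨m, hm ▸ (hE.mm_left _).mono ?_⟩
      simp
    | succ N ih =>
      obtain ⟨n₀, hn₀⟩ := ih
      obtain ⟨n, hn, m, E, hm, hEfin, hE⟩ := hblock n₀
      obtain ⟨G, hG⟩ := hF n₀ n hn
      refine ⟨m, ?_⟩
      have hFn : CrossRatioLE (1 + (q ^ N * D : NNReal)) (F n) := hG ▸ hn₀.mm_right G
      have := hFn.contract hqD hE (hfin n) hEfin
      rw [hm]
      convert this using 2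
      push_cast
      ring
  have hlim : Tendsto (fun N : ℕ => ((q ^ N * D : NNReal) : ENNReal)) atTop (𝓝 0) := by
    rw [← ENNReal.coe_zero, ENNReal.tendsto_coe]
    simpa using (NNReal.tendsto_pow_atTop_nhds_zero_of_lt_one hq1).mul_const D
  obtain ⟨N, hN⟩ := (hlim.eventually (gt_mem_nhds (pos_iff_ne_zero.2 hε))).exists
  obtain ⟨n₀, hn₀⟩ := step N
  filter_upwards [eventually_ge_atTop n₀] with n hn
  obtain ⟨G, hG⟩ := hF n₀ n hn
  rw [hG]
  exact (hn₀.mono (by gcongr)).mm_right G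

theorem CrossRatioLE.mm_mul_le {κ : ENNReal} {F : ℕ → ℕ → ENNReal} (hF : CrossRatioLE κ F)
    (G : ℕ → ℕ → ENNReal) (i j k l : ℕ) :
    mm F G i l * F k j ≤ κ * (F i j * mm F G k l) := by
  simp only [mm, ← ENNReal.tsum_mul_left, ← ENNReal.tsum_mul_right]
  refine ENNReal.tsum_le_tsum fun a => ?_
  calc _ = (F i a * F k j) * G a l := by ring
    _ ≤ (κ * (F i j * F k a)) * G a l := mul_le_mul_left (hF _ _ _ _) _
    _ = _ := by ring

/-- A nested sequence of finite matrices with cross ratios tending to `1` whose rows outside `ok`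
vanish and whose entries in the columns `l n` and the rows in `ok` are eventually positive. -/
structure Regular (F : ℕ → ℕ → ℕ → ENNReal) (ok : ℕ → Prop) (l : ℕ → ℕ) : Prop where
  nested : Nested F
  fin : ∀ n i j, F n i j ≠ ⊤
  cross : ∀ ε : ENNReal, ε ≠ 0 → ∀ᶠ n in atTop, CrossRatioLE (1 + ε) (F n)
  pos : ∀ᶠ n in atTop, ∀ i, ok i → F n i (l n) ≠ 0
  zero : ∀ᶠ n in atTop, ∀ i, ¬ ok i → ∀ j, F n i j = 0

/-- The asymptotic direction of the columns of `F n`, normalized at the coordinate `i₀`. -/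
def direction (F : ℕ → ℕ → ℕ → ENNReal) (l : ℕ → ℕ) (i₀ i : ℕ) : ENNReal :=
  limsup (fun n => F n i (l n) / F n i₀ (l n)) atTop

theorem direction_eq_zero {F : ℕ → ℕ → ℕ → ENNReal} {l : ℕ → ℕ} {i₀ i : ℕ}
    (h : ∀ᶠ n in atTop, ∀ j, F n i j = 0) : direction F l i₀ i = 0 := by
  have : (fun n => F n i (l n) / F n i₀ (l n)) =ᶠ[atTop] fun _ => 0 := by
    filter_upwards [h] with n hn
    simp [hn]
  rw [direction, limsup_congr this, limsup_const]

namespace Regular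

variable {F F' : ℕ → ℕ → ℕ → ENNReal} {ok ok' : ℕ → Prop} {l l' : ℕ → ℕ} {i₀ i₀' : ℕ}

theorem direction_bounds (R : Regular F ok l) (hi₀ : ok i₀) {ε : ENNReal} (hε : ε ≠ 0)
    (hε' : ε ≠ ⊤) :
    ∀ᶠ n in atTop, ∀ i j, direction F l i₀ i * F n i₀ j ≤ (1 + ε) * F n i j ∧
      F n i j ≤ (1 + ε) * (direction F l i₀ i * F n i₀ j) := by
  filter_upwards [R.cross ε hε] with n hn i j
  constructor
  · by_cases h0 : F n i₀ j = 0
    · simp [h0]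
    rw [← ENNReal.le_div_iff_mul_le (Or.inl h0) (Or.inl (R.fin _ _ _))]
    refine limsup_le_of_le (by isBoundedDefault) ?_
    filter_upwards [R.pos, eventually_ge_atTop n] with m hm hnm
    obtain ⟨G, hG⟩ := R.nested n m hnm
    rw [ENNReal.le_div_iff_mul_le (Or.inl h0) (Or.inl (R.fin _ _ _)), ENNReal.div_eq_inv_mul,
      mul_assoc, ← ENNReal.div_eq_inv_mul]
    refine ENNReal.div_le_of_le_mul ?_
    have := hn.mm_mul_le G i j i₀ (l m)
    rw [← hG] at this
    rwa [mul_assoc]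
  · have key : ∀ᶠ m in atTop, F n i j ≤
        F m i (l m) / F m i₀ (l m) * ((1 + ε) * F n i₀ j) := by
      filter_upwards [R.pos, eventually_ge_atTop n] with m hm hnm
      obtain ⟨G, hG⟩ := R.nested n m hnm
      rw [ENNReal.div_eq_inv_mul, mul_assoc, ← ENNReal.div_eq_inv_mul,
        ENNReal.le_div_iff_mul_le (Or.inl (hm _ hi₀)) (Or.inl (R.fin _ _ _))]
      have := hn.mm_mul_le G i₀ j i (l m)
      rw [← hG] at this
      calc _ = F m i₀ (l m) * F n i j := mul_comm _ _
        _ ≤ _ := this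
        _ = _ := by ring
    have hK : (1 + ε) * F n i₀ j ≠ ⊤ :=
      ENNReal.mul_ne_top (by simp [hε']) (R.fin _ _ _)
    by_cases h0 : (1 + ε) * F n i₀ j = 0
    · obtain ⟨m, hm⟩ := key.exists
      rw [h0, mul_zero] at hm
      exact hm.trans (zero_le)
    have h1 : F n i j / ((1 + ε) * F n i₀ j) ≤ direction F l i₀ i := by
      refine le_limsup_of_frequently_le (Eventually.frequently ?_) (by isBoundedDefault)
      filter_upwards [key] with m hm
      exact ENNReal.div_le_of_le_mul hm
    rw [ENNReal.div_le_iff h0 hK] at h1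
    calc _ ≤ _ := h1
      _ = _ := by ring

theorem direction_pos (R : Regular F ok l) (hi₀ : ok i₀) {i : ℕ} (hi : ok i) :
    direction F l i₀ i ≠ 0 := by
  obtain ⟨n, hn, hpos⟩ :=
    ((R.direction_bounds hi₀ one_ne_zero ENNReal.one_ne_top).and R.pos).exists
  intro h0
  have := (hn i (l n)).2
  rw [h0, zero_mul, mul_zero] at this
  exact hpos i hi (le_antisymm this (zero_le))

theorem direction_ne_top (R : Regular F ok l) (hi₀ : ok i₀) (i : ℕ) :
    direction F l i₀ i ≠ ⊤ := by
  obtain ⟨n, hn, hpos⟩ :=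
    ((R.direction_bounds hi₀ one_ne_zero ENNReal.one_ne_top).and R.pos).exists
  intro h0
  have := (hn i (l n)).1
  rw [h0, ENNReal.top_mul (hpos _ hi₀), top_le_iff] at this
  exact ENNReal.mul_ne_top (by norm_num) (R.fin _ _ _) this

theorem tsum_direction_mul_ne_top (R : Regular F ok l) (R' : Regular F' ok l') (hi₀ : ok i₀)
    (h : ∀ n m j k, ∑' i, F n i j * F' m i k ≠ ⊤) :
    ∑' i, direction F l i₀ i * direction F' l' i₀ i ≠ ⊤ := by
  obtain ⟨n, hn, hpos⟩ :=
    ((R.direction_bounds hi₀ one_ne_zero ENNReal.one_ne_top).and R.pos).exists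
  obtain ⟨m, hm, hpos'⟩ :=
    ((R'.direction_bounds hi₀ one_ne_zero ENNReal.one_ne_top).and R'.pos).exists
  have key : (∑' i, direction F l i₀ i * direction F' l' i₀ i) *
      (F n i₀ (l n) * F' m i₀ (l' m)) ≤ (1 + 1) * (1 + 1) * ∑' i, F n i (l n) * F' m i (l' m) := by
    rw [← ENNReal.tsum_mul_right, ← ENNReal.tsum_mul_left]
    refine ENNReal.tsum_le_tsum fun i => ?_
    calc _ = (direction F l i₀ i * F n i₀ (l n)) * (direction F' l' i₀ i * F' m i₀ (l' m)) := by
          ring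
      _ ≤ ((1 + 1) * F n i (l n)) * ((1 + 1) * F' m i (l' m)) :=
          mul_le_mul' (hn _ _).1 (hm _ _).1
      _ = _ := by ring
  intro htop
  rw [htop, ENNReal.top_mul (mul_ne_zero (hpos _ hi₀) (hpos' _ hi₀)), top_le_iff] at key
  exact ENNReal.mul_ne_top (by norm_num) (h _ _ _ _) key

end Regular

theorem le_of_forall_le_pow_mul {a b : ENNReal} (k : ℕ)
    (h : ∀ ε : ENNReal, ε ≠ 0 → ε ≠ ⊤ → a ≤ (1 + ε) ^ k * b) : a ≤ b := by
  have hlim : Tendsto (fun n : ℕ => (1 + (n : ENNReal)⁻¹) ^ k * b) atTop (𝓝 b) := by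
    have h1 : Tendsto (fun n : ℕ => (1 + (n : ENNReal)⁻¹) ^ k) atTop (𝓝 1) := by
      simpa using ENNReal.Tendsto.pow (n := k) (ENNReal.tendsto_inv_nat_nhds_zero.const_add 1)
    simpa using ENNReal.Tendsto.mul_const h1 (Or.inl one_ne_zero) (b := b)
  refine ge_of_tendsto hlim ?_
  filter_upwards [eventually_ge_atTop 1] with n hn
  refine h _ (by simp) ?_
  simp only [ne_eq, ENNReal.inv_eq_top, Nat.cast_eq_zero]
  omega

namespace Regular

variable {F F' : ℕ → ℕ → ℕ → ENNReal} {ok ok' : ℕ → Prop} {l l' : ℕ → ℕ} {i₀ i₀' : ℕ}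
  {A : ℕ → ℕ → ENNReal}

theorem step_bounds (R' : Regular F' ok' l') (hi₀' : ok' i₀')
    (hstep : ∀ n, F (n + 1) = mm A (F' n)) {ε : ENNReal} (hε : ε ≠ 0) (hε' : ε ≠ ⊤) :
    ∀ᶠ n in atTop, ∀ i j,
      (∑' k, A i k * direction F' l' i₀' k) * F' n i₀' j ≤ (1 + ε) * F (n + 1) i j ∧
      F (n + 1) i j ≤ (1 + ε) * ((∑' k, A i k * direction F' l' i₀' k) * F' n i₀' j) := by
  filter_upwards [R'.direction_bounds hi₀' hε hε'] with n hn i j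
  rw [hstep, mm, ← ENNReal.tsum_mul_right, ← ENNReal.tsum_mul_left, ← ENNReal.tsum_mul_left]
  constructor
  · refine ENNReal.tsum_le_tsum fun k => ?_
    calc _ = A i k * (direction F' l' i₀' k * F' n i₀' j) := by ring
      _ ≤ A i k * ((1 + ε) * F' n k j) := mul_le_mul_right (hn _ _).1 _
      _ = _ := by ring
  · refine ENNReal.tsum_le_tsum fun k => ?_
    calc _ ≤ A i k * ((1 + ε) * (direction F' l' i₀' k * F' n i₀' j)) :=
          mul_le_mul_right (hn _ _).2 _
      _ = _ := by ring

theorem eigen_factor_pos_ne_top (R : Regular F ok l) (R' : Regular F' ok' l') (hi₀ : ok i₀)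
    (hi₀' : ok' i₀') (hstep : ∀ n, F (n + 1) = mm A (F' n)) (hl : ∀ n, l (n + 1) = l' n) :
    ∑' k, A i₀ k * direction F' l' i₀' k ≠ 0 ∧ ∑' k, A i₀ k * direction F' l' i₀' k ≠ ⊤ := by
  obtain ⟨n, ⟨hn, hpos⟩, hpos'⟩ := (((R'.step_bounds hi₀' hstep one_ne_zero
    ENNReal.one_ne_top).and ((tendsto_add_atTop_nat 1).eventually R.pos)).and R'.pos).exists
  have h := hn i₀ (l' n)
  constructor <;> intro h0 <;> rw [h0] at h
  · have := hpos _ hi₀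
    rw [hl] at this
    refine this (le_antisymm (by simpa using h.2) (zero_le))
  · have := h.1
    rw [ENNReal.top_mul (hpos' _ hi₀'), top_le_iff] at this
    exact ENNReal.mul_ne_top (by norm_num) (R.fin _ _ _) this

theorem eigen_direction (R : Regular F ok l) (R' : Regular F' ok' l') (hi₀ : ok i₀)
    (hi₀' : ok' i₀') (hstep : ∀ n, F (n + 1) = mm A (F' n)) (i : ℕ) :
    ∑' k, A i k * direction F' l' i₀' k =
      (∑' k, A i₀ k * direction F' l' i₀' k) * direction F l i₀ i := by
  set T : ℕ → ENNReal := fun i => ∑' k, A i k * direction F' l' i₀' k with hT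
  change T i = T i₀ * direction F l i₀ i
  have ev : ∀ ε : ENNReal, ε ≠ 0 → ε ≠ ⊤ → T i ≤ (1 + ε) ^ 3 * (T i₀ * direction F l i₀ i) ∧
      T i₀ * direction F l i₀ i ≤ (1 + ε) ^ 3 * T i := by
    intro ε hε hε'
    obtain ⟨n, ⟨hn, hn'⟩, hpos'⟩ := (((R'.step_bounds hi₀' hstep hε hε').and
      ((tendsto_add_atTop_nat 1).eventually (R.direction_bounds hi₀ hε hε'))).and R'.pos).exists
    have hc := hpos' _ hi₀'
    have hc' := R'.fin n i₀' (l' n)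
    set c := F' n i₀' (l' n)
    obtain ⟨a1, a2⟩ := hn i (l' n)
    obtain ⟨b1, b2⟩ := hn i₀ (l' n)
    obtain ⟨d1, d2⟩ := hn' i (l' n)
    constructor
    · rw [← ENNReal.mul_le_mul_iff_left hc hc']
      calc T i * c ≤ (1 + ε) * F (n + 1) i (l' n) := a1
        _ ≤ (1 + ε) * ((1 + ε) * (direction F l i₀ i * ((1 + ε) * (T i₀ * c)))) := by
          gcongr
          exact d2.trans (by gcongr)
        _ = _ := by ring
    · rw [← ENNReal.mul_le_mul_iff_left hc hc']
      calc T i₀ * direction F l i₀ i * c = direction F l i₀ i * (T i₀ * c) := by ring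
        _ ≤ direction F l i₀ i * ((1 + ε) * F (n + 1) i₀ (l' n)) := by gcongr
        _ = (1 + ε) * (direction F l i₀ i * F (n + 1) i₀ (l' n)) := by ring
        _ ≤ (1 + ε) * ((1 + ε) * ((1 + ε) * (T i * c))) := by
          exact mul_le_mul_right (d1.trans (mul_le_mul_right a2 _)) _
        _ = _ := by ring
  exact le_antisymm (le_of_forall_le_pow_mul 3 fun ε h h' => (ev ε h h').1)
    (le_of_forall_le_pow_mul 3 fun ε h h' => (ev ε h h').2)

end Regular

/-- The nonnegative matrix `p` is supported on the available letters and its signum is the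
transition matrix of the chain `S`. -/
structure Compatible (S : Chain Ω) (p : Ω → ℕ → ℕ → ℝ) : Prop where
  nonneg : ∀ ω i j, 0 ≤ p ω i j
  range : ∀ ω i j, ¬(S.letterOK ω i = true ∧ S.letterOK (S.θ ω) j = true) → p ω i j = 0
  sgn : ∀ ω i j, S.letterOK ω i = true → S.letterOK (S.θ ω) j = true →
    (S.tr ω i j = true ↔ 0 < p ω i j)

/-- The `[0, ∞]`-valued version of the random matrix `p`. -/
def entry (p : Ω → ℕ → ℕ → ℝ) (ω : Ω) (i j : ℕ) : ENNReal := ENNReal.ofReal (p ω i j)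

/-- The `[0, ∞]`-valued version of the matrix products `matProd`. -/
def eprod (S : Chain Ω) (p : Ω → ℕ → ℕ → ℝ) (ω : Ω) : ℕ → ℕ → ℕ → ENNReal
  | 0 => fun i j => if i = j then 1 else 0
  | n + 1 => mm (eprod S p ω n) (entry p (S.θ^[n] ω))

/-- The column sums of the matrix at `ω` are uniformly bounded, and no admissible column
vanishes. -/
def ColumnRegular (S : Chain Ω) (p : Ω → ℕ → ℕ → ℝ) (ω : Ω) : Prop :=
  (∃ M : ENNReal, M ≠ ⊤ ∧ ∀ j, ∑' i, entry p ω i j ≤ M) ∧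
    ∀ j, S.letterOK (S.θ ω) j = true → ∃ i, entry p ω i j ≠ 0

/-- The matrix product of length `L` starting at `ω` is positive with cross ratios at most `D`. -/
def IsBlock (S : Chain Ω) (p : Ω → ℕ → ℕ → ℝ) (D L : ℕ) (ω : Ω) : Prop :=
  CrossRatioLE D (eprod S p ω L) ∧
    ∀ i j, S.letterOK ω i = true → S.letterOK (S.θ^[L] ω) j = true → eprod S p ω L i j ≠ 0

section Products

variable {S : Chain Ω} {p : Ω → ℕ → ℕ → ℝ} {ω : Ω}

theorem mm_one (A : ℕ → ℕ → ENNReal) : mm A (fun i j => if i = j then 1 else 0) = A := by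
  funext i j
  simp [mm]

theorem one_mm (A : ℕ → ℕ → ENNReal) : mm (fun i j => if i = j then 1 else 0) A = A := by
  funext i j
  simp [mm]

theorem mm_ne_zero {A B : ℕ → ℕ → ENNReal} {i j k : ℕ} (hA : A i k ≠ 0) (hB : B k j ≠ 0) :
    mm A B i j ≠ 0 := by
  intro h
  rw [mm, ENNReal.tsum_eq_zero] at h
  exact mul_ne_zero hA hB (h k)

theorem eprod_add (S : Chain Ω) (p : Ω → ℕ → ℕ → ℝ) (ω : Ω) (n m : ℕ) :
    eprod S p ω (n + m) = mm (eprod S p ω n) (eprod S p (S.θ^[n] ω) m) := by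
  induction m with
  | zero => exact (mm_one _).symm
  | succ m ih =>
    rw [← add_assoc, eprod, ih, mm_assoc, eprod, ← Function.iterate_add_apply, add_comm m n]

theorem eprod_one (S : Chain Ω) (p : Ω → ℕ → ℕ → ℝ) (ω : Ω) : eprod S p ω 1 = entry p ω :=
  one_mm _

theorem eprod_succ' (S : Chain Ω) (p : Ω → ℕ → ℕ → ℝ) (ω : Ω) (n : ℕ) :
    eprod S p ω (n + 1) = mm (entry p ω) (eprod S p (S.θ ω) n) := by
  rw [add_comm, eprod_add, eprod_one]
  rfl

theorem entry_ne_zero_iff {α : Type*} {p : α → ℕ → ℕ → ℝ} {ω : α} {i j : ℕ} :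
    entry p ω i j ≠ 0 ↔ 0 < p ω i j := by
  simp [entry]

theorem Compatible.ok_of_entry_ne_zero (hc : Compatible S p) {i j : ℕ} (h : entry p ω i j ≠ 0) :
    S.letterOK ω i = true ∧ S.letterOK (S.θ ω) j = true := by
  by_contra hn
  simp [entry, hc.range ω i j hn] at h

theorem Compatible.eprod_eq_zero_left (hc : Compatible S p) {n : ℕ} (hn : 1 ≤ n) {i : ℕ}
    (hi : ¬ S.letterOK ω i = true) (j : ℕ) : eprod S p ω n i j = 0 := by
  obtain ⟨n, rfl⟩ := Nat.exists_eq_add_of_le' hn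
  rw [eprod_succ', mm, ENNReal.tsum_eq_zero]
  intro k
  by_contra h
  exact hi (hc.ok_of_entry_ne_zero (left_ne_zero_of_mul h)).1

theorem Compatible.eprod_eq_zero_right (hc : Compatible S p) {n : ℕ} (hn : 1 ≤ n) {j : ℕ}
    (hj : ¬ S.letterOK (S.θ^[n] ω) j = true) (i : ℕ) : eprod S p ω n i j = 0 := by
  obtain ⟨n, rfl⟩ := Nat.exists_eq_add_of_le' hn
  rw [eprod, mm, ENNReal.tsum_eq_zero]
  intro k
  by_contra h
  rw [Function.iterate_succ_apply'] at hj
  exact hj (hc.ok_of_entry_ne_zero (right_ne_zero_of_mul h)).2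

theorem Compatible.exists_entry_ne_zero (hc : Compatible S p) {i : ℕ}
    (hi : S.letterOK ω i = true) :
    ∃ j, S.letterOK (S.θ ω) j = true ∧ entry p ω i j ≠ 0 := by
  obtain ⟨j, hj, hij⟩ := S.no_zero_row ω i hi
  exact ⟨j, hj, entry_ne_zero_iff.2 ((hc.sgn ω i j hi hj).1 hij)⟩

theorem Compatible.exists_eprod_ne_zero_row (hc : Compatible S p) (n : ℕ) {i : ℕ}
    (hi : S.letterOK ω i = true) :
    ∃ j, S.letterOK (S.θ^[n] ω) j = true ∧ eprod S p ω n i j ≠ 0 := by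
  induction n with
  | zero => exact ⟨i, hi, by simp [eprod]⟩
  | succ n ih =>
    obtain ⟨k, hk, hik⟩ := ih
    obtain ⟨j, hj, hkj⟩ := hc.exists_entry_ne_zero hk
    rw [Function.iterate_succ_apply']
    exact ⟨j, hj, mm_ne_zero hik hkj⟩

theorem Compatible.exists_eprod_ne_zero_col (hc : Compatible S p)
    (hcol : ∀ k, ColumnRegular S p (S.θ^[k] ω)) (n : ℕ) {j : ℕ}
    (hj : S.letterOK (S.θ^[n] ω) j = true) :
    ∃ i, S.letterOK ω i = true ∧ eprod S p ω n i j ≠ 0 := by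
  induction n generalizing j with
  | zero => exact ⟨j, hj, by simp [eprod]⟩
  | succ n ih =>
    rw [Function.iterate_succ_apply'] at hj
    obtain ⟨k, hkj⟩ := (hcol n).2 j hj
    obtain ⟨i, hi, hik⟩ := ih (hc.ok_of_entry_ne_zero hkj).1
    exact ⟨i, hi, mm_ne_zero hik hkj⟩

theorem eprod_column_sum_le (hcol : ∀ k, ColumnRegular S p (S.θ^[k] ω)) (n : ℕ) :
    ∃ M : ENNReal, M ≠ ⊤ ∧ ∀ j, ∑' i, eprod S p ω n i j ≤ M := by
  induction n with
  | zero => exact ⟨1, ENNReal.one_ne_top, fun j => by simp [eprod]⟩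
  | succ n ih =>
    obtain ⟨M, hM, h⟩ := ih
    obtain ⟨M', hM', h'⟩ := (hcol n).1
    refine ⟨M * M', ENNReal.mul_ne_top hM hM', fun j => ?_⟩
    simp only [eprod, mm]
    rw [ENNReal.tsum_comm]
    simp only [ENNReal.tsum_mul_right]
    calc _ ≤ ∑' k, M * entry p (S.θ^[n] ω) k j :=
          ENNReal.tsum_le_tsum fun k => mul_le_mul_left (h k) _
      _ ≤ M * M' := by
          rw [ENNReal.tsum_mul_left]
          exact mul_le_mul_right (h' j) _

theorem eprod_ne_top (hcol : ∀ k, ColumnRegular S p (S.θ^[k] ω)) (n i j : ℕ) :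
    eprod S p ω n i j ≠ ⊤ := by
  obtain ⟨M, hM, h⟩ := eprod_column_sum_le hcol n
  exact ne_top_of_le_ne_top hM ((ENNReal.le_tsum i).trans (h j))

theorem matProd_eq_toReal (hc : Compatible S p) (hcol : ∀ k, ColumnRegular S p (S.θ^[k] ω))
    (n i j : ℕ) : matProd S p ω n i j = (eprod S p ω n i j).toReal := by
  induction n generalizing j with
  | zero =>
    simp only [matProd, eprod]
    split_ifs <;> simp
  | succ n ih =>
    simp only [matProd, eprod, mm, entry]
    rw [ENNReal.tsum_toReal_eq fun k =>
      ENNReal.mul_ne_top (eprod_ne_top hcol n i k) ENNReal.ofReal_ne_top]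
    refine tsum_congr fun k => ?_
    rw [ih, ENNReal.toReal_mul, ENNReal.toReal_ofReal (hc.nonneg _ _ _)]

theorem IsBlock.eprod_ne_zero (hc : Compatible S p) (hcol : ∀ k, ColumnRegular S p (S.θ^[k] ω))
    {D L : ℕ} {a : ℕ} (hb : IsBlock S p D L (S.θ^[a] ω)) {n : ℕ} (hn : a + L ≤ n) {i j : ℕ}
    (hi : S.letterOK ω i = true) (hj : S.letterOK (S.θ^[n] ω) j = true) :
    eprod S p ω n i j ≠ 0 := by
  obtain ⟨b, rfl⟩ := Nat.exists_eq_add_of_le hn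
  rw [eprod_add, eprod_add]
  obtain ⟨k, hk, hik⟩ := hc.exists_eprod_ne_zero_row a hi
  have hcol' : ∀ k, ColumnRegular S p (S.θ^[k] (S.θ^[a + L] ω)) := fun k => by
    rw [← Function.iterate_add_apply]
    exact hcol _
  rw [add_comm (a + L), Function.iterate_add_apply] at hj
  obtain ⟨m, hm, hmj⟩ := hc.exists_eprod_ne_zero_col hcol' b hj
  refine mm_ne_zero (mm_ne_zero hik (hb.2 k m hk ?_)) hmj
  rwa [← Function.iterate_add_apply, add_comm L]

theorem iterate_θ_θinv (S : Chain Ω) (n k : ℕ) (ω : Ω) :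
    S.θ^[k] (S.θinv^[n + k] ω) = S.θinv^[n] ω := by
  rw [add_comm, Function.iterate_add_apply]
  exact (S.θ_right_inv.iterate k) _

end Products

/-- The orbit of `ω` has regular columns and meets blocks infinitely often in both directions. -/
structure GoodPoint (S : Chain Ω) (p : Ω → ℕ → ℕ → ℝ) (D L : ℕ) (ω : Ω) : Prop where
  col : ∀ n k, ColumnRegular S p (S.θ^[k] (S.θinv^[n] ω))
  fwd : ∃ᶠ n in atTop, IsBlock S p D L (S.θ^[n] ω)
  bwd : ∃ᶠ n in atTop, IsBlock S p D L (S.θinv^[n] ω)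

/-- An available letter at `ω`. -/
def baseLetter (S : Chain Ω) (ω : Ω) : ℕ := (S.two_letters ω).choose

theorem baseLetter_ok (S : Chain Ω) (ω : Ω) : S.letterOK ω (baseLetter S ω) = true := by
  obtain ⟨j, -, h, -⟩ := (S.two_letters ω).choose_spec
  exact h

/-- The transposed products ending at `ω`. -/
def backProd (S : Chain Ω) (p : Ω → ℕ → ℕ → ℝ) (ω : Ω) (n : ℕ) : ℕ → ℕ → ENNReal :=
  Function.swap (eprod S p (S.θinv^[n] ω) n)

namespace GoodPoint

variable {S : Chain Ω} {p : Ω → ℕ → ℕ → ℝ} {ω : Ω} {D L : ℕ}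

theorem regular_forward (hc : Compatible S p) (hD : 1 ≤ D) (hg : GoodPoint S p D L ω) :
    Regular (eprod S p ω) (fun i => S.letterOK ω i = true)
      (fun n => baseLetter S (S.θ^[n] ω)) := by
  have hcol : ∀ k, ColumnRegular S p (S.θ^[k] ω) := hg.col 0
  have hcol' : ∀ n k, ColumnRegular S p (S.θ^[k] (S.θ^[n] ω)) := fun n k => by
    rw [← Function.iterate_add_apply]
    exact hcol _
  have hnest : Nested (eprod S p ω) := fun n m hnm => by
    obtain ⟨k, rfl⟩ := Nat.exists_eq_add_of_le hnm
    exact ⟨_, eprod_add S p ω n k⟩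
  refine ⟨hnest, eprod_ne_top hcol, fun ε hε => ?_, ?_, ?_⟩
  · refine eventually_crossRatioLE hnest (eprod_ne_top hcol) (D := D) (by exact_mod_cast hD)
      (fun N => ?_) hε
    obtain ⟨n, hn, hb⟩ := frequently_atTop.1 hg.fwd N
    exact ⟨n, hn, n + L, _, eprod_add S p ω n L, eprod_ne_top (hcol' n) L,
      by simpa using hb.1⟩
  · obtain ⟨n, hb⟩ := hg.fwd.exists
    filter_upwards [eventually_ge_atTop (n + L)] with m hm i hi
    exact hb.eprod_ne_zero hc hcol hm hi (baseLetter_ok S _)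
  · filter_upwards [eventually_ge_atTop 1] with n hn i hi j
    exact hc.eprod_eq_zero_left hn hi j

theorem regular_backward (hc : Compatible S p) (hD : 1 ≤ D) (hg : GoodPoint S p D L ω) :
    Regular (backProd S p ω) (fun i => S.letterOK ω i = true)
      (fun n => baseLetter S (S.θinv^[n] ω)) := by
  have hsplit : ∀ n k, backProd S p ω (n + k) =
      mm (backProd S p ω n) (Function.swap (eprod S p (S.θinv^[n + k] ω) k)) := fun n k => by
    rw [backProd, backProd, ← mm_swap]
    nth_rw 2 [add_comm n k]
    rw [eprod_add, iterate_θ_θinv]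
  have hnest : Nested (backProd S p ω) := fun n m hnm => by
    obtain ⟨k, rfl⟩ := Nat.exists_eq_add_of_le hnm
    exact ⟨_, hsplit n k⟩
  have hfin : ∀ n i j, backProd S p ω n i j ≠ ⊤ := fun n i j => eprod_ne_top (hg.col n) n j i
  have hend : ∀ n, S.θ^[n] (S.θinv^[n] ω) = ω := fun n => by
    simpa using iterate_θ_θinv S 0 n ω
  refine ⟨hnest, hfin, fun ε hε => ?_, ?_, ?_⟩
  · refine eventually_crossRatioLE hnest hfin (D := D) (by exact_mod_cast hD) (fun N => ?_) hε
    obtain ⟨n, hn, hb⟩ := frequently_atTop.1 hg.bwd (N + L)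
    obtain ⟨k, rfl⟩ := Nat.exists_eq_add_of_le' (show L ≤ n by omega)
    exact ⟨k, by omega, k + L, _, hsplit k L, fun i j => eprod_ne_top (hg.col _) L j i,
      by simpa using hb.1.swap⟩
  · obtain ⟨n, hn, hb⟩ := frequently_atTop.1 hg.bwd L
    filter_upwards [eventually_ge_atTop n] with m hm i hi
    obtain ⟨k, rfl⟩ := Nat.exists_eq_add_of_le hm
    rw [← iterate_θ_θinv S n k ω] at hb
    exact hb.eprod_ne_zero hc (hg.col _) (by omega) (baseLetter_ok S _) (by rwa [hend])
  · filter_upwards [eventually_ge_atTop 1] with n hn i hi j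
    exact hc.eprod_eq_zero_right hn (by rwa [hend]) j

end GoodPoint

/-- The left eigenvector, normalized to be `1` at the base letter. -/
def leftVec (S : Chain Ω) (p : Ω → ℕ → ℕ → ℝ) (ω : Ω) : ℕ → ENNReal :=
  direction (backProd S p ω) (fun n => baseLetter S (S.θinv^[n] ω)) (baseLetter S ω)

/-- The right eigenvector, normalized to be `1` at the base letter. -/
def rightDir (S : Chain Ω) (p : Ω → ℕ → ℕ → ℝ) (ω : Ω) : ℕ → ENNReal :=
  direction (eprod S p ω) (fun n => baseLetter S (S.θ^[n] ω)) (baseLetter S ω)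

/-- The pairing of the two eigenvectors. -/
def pairing (S : Chain Ω) (p : Ω → ℕ → ℕ → ℝ) (ω : Ω) : ENNReal :=
  ∑' i, leftVec S p ω i * rightDir S p ω i

/-- The right eigenvector, normalized so that its pairing with the left eigenvector is `1`. -/
def rightVec (S : Chain Ω) (p : Ω → ℕ → ℕ → ℝ) (ω : Ω) (i : ℕ) : ENNReal :=
  rightDir S p ω i / pairing S p ω

/-- The eigenvalue of the left eigenvector. -/
def eigenvalue (S : Chain Ω) (p : Ω → ℕ → ℕ → ℝ) (ω : Ω) : ENNReal :=
  ∑' i, entry p ω i (baseLetter S (S.θ ω)) * leftVec S p ω i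

theorem backProd_step (S : Chain Ω) (p : Ω → ℕ → ℕ → ℝ) (ω : Ω) (n : ℕ) :
    backProd S p (S.θ ω) (n + 1) = mm (Function.swap (entry p ω)) (backProd S p ω n) := by
  rw [backProd, backProd, ← mm_swap, Function.iterate_succ_apply, S.θ_left_inv, eprod]
  congr 3
  simpa using iterate_θ_θinv S 0 n ω

theorem Compatible.leftVec_eq_zero {S : Chain Ω} {p : Ω → ℕ → ℕ → ℝ} (hc : Compatible S p)
    {ω : Ω} {i : ℕ} (hi : ¬ S.letterOK ω i = true) : leftVec S p ω i = 0 := by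
  refine direction_eq_zero ?_
  filter_upwards [eventually_ge_atTop 1] with n hn j
  refine hc.eprod_eq_zero_right hn ?_ j
  rwa [show S.θ^[n] (S.θinv^[n] ω) = ω by simpa using iterate_θ_θinv S 0 n ω]

theorem Compatible.rightVec_eq_zero {S : Chain Ω} {p : Ω → ℕ → ℕ → ℝ} (hc : Compatible S p)
    {ω : Ω} {i : ℕ} (hi : ¬ S.letterOK ω i = true) : rightVec S p ω i = 0 := by
  have : rightDir S p ω i = 0 := by
    refine direction_eq_zero ?_
    filter_upwards [eventually_ge_atTop 1] with n hn j
    exact hc.eprod_eq_zero_left hn hi j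
  simp [rightVec, this]

namespace GoodPoint

variable {S : Chain Ω} {p : Ω → ℕ → ℕ → ℝ} {ω : Ω} {D L : ℕ}

theorem leftVec_ne_top (hc : Compatible S p) (hD : 1 ≤ D) (hg : GoodPoint S p D L ω) (i : ℕ) :
    leftVec S p ω i ≠ ⊤ :=
  (hg.regular_backward hc hD).direction_ne_top (baseLetter_ok S ω) i

theorem leftVec_ne_zero (hc : Compatible S p) (hD : 1 ≤ D) (hg : GoodPoint S p D L ω) {i : ℕ}
    (hi : S.letterOK ω i = true) : leftVec S p ω i ≠ 0 :=
  (hg.regular_backward hc hD).direction_pos (baseLetter_ok S ω) hi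

theorem rightDir_ne_top (hc : Compatible S p) (hD : 1 ≤ D) (hg : GoodPoint S p D L ω) (i : ℕ) :
    rightDir S p ω i ≠ ⊤ :=
  (hg.regular_forward hc hD).direction_ne_top (baseLetter_ok S ω) i

theorem rightDir_ne_zero (hc : Compatible S p) (hD : 1 ≤ D) (hg : GoodPoint S p D L ω) {i : ℕ}
    (hi : S.letterOK ω i = true) : rightDir S p ω i ≠ 0 :=
  (hg.regular_forward hc hD).direction_pos (baseLetter_ok S ω) hi

theorem pairing_ne_zero (hc : Compatible S p) (hD : 1 ≤ D) (hg : GoodPoint S p D L ω) :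
    pairing S p ω ≠ 0 := by
  rw [pairing, Ne, ENNReal.tsum_eq_zero]
  intro h
  exact mul_ne_zero (hg.leftVec_ne_zero hc hD (baseLetter_ok S ω))
    (hg.rightDir_ne_zero hc hD (baseLetter_ok S ω)) (h _)

theorem pairing_ne_top (hc : Compatible S p) (hD : 1 ≤ D) (hg : GoodPoint S p D L ω) :
    pairing S p ω ≠ ⊤ := by
  refine (hg.regular_backward hc hD).tsum_direction_mul_ne_top (hg.regular_forward hc hD)
    (baseLetter_ok S ω) fun n m j k => ?_
  have := eprod_ne_top (hg.col n) (n + m) j k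
  rwa [eprod_add, show S.θ^[n] (S.θinv^[n] ω) = ω by simpa using iterate_θ_θinv S 0 n ω] at this

theorem rightVec_ne_top (hc : Compatible S p) (hD : 1 ≤ D) (hg : GoodPoint S p D L ω) (i : ℕ) :
    rightVec S p ω i ≠ ⊤ :=
  ENNReal.div_ne_top (hg.rightDir_ne_top hc hD i) (hg.pairing_ne_zero hc hD)

theorem rightVec_ne_zero (hc : Compatible S p) (hD : 1 ≤ D) (hg : GoodPoint S p D L ω) {i : ℕ}
    (hi : S.letterOK ω i = true) : rightVec S p ω i ≠ 0 :=
  ENNReal.div_ne_zero.2 ⟨hg.rightDir_ne_zero hc hD hi, hg.pairing_ne_top hc hD⟩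

theorem tsum_leftVec_mul_rightVec (hc : Compatible S p) (hD : 1 ≤ D)
    (hg : GoodPoint S p D L ω) : ∑' i, leftVec S p ω i * rightVec S p ω i = 1 := by
  simp only [rightVec, div_eq_mul_inv, ← mul_assoc]
  rw [ENNReal.tsum_mul_right]
  exact ENNReal.mul_inv_cancel (hg.pairing_ne_zero hc hD) (hg.pairing_ne_top hc hD)

theorem eigenvalue_ne_zero_ne_top (hc : Compatible S p) (hD : 1 ≤ D) (hg : GoodPoint S p D L ω)
    (hg' : GoodPoint S p D L (S.θ ω)) : eigenvalue S p ω ≠ 0 ∧ eigenvalue S p ω ≠ ⊤ :=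
  (hg'.regular_backward hc hD).eigen_factor_pos_ne_top (hg.regular_backward hc hD)
    (baseLetter_ok S _) (baseLetter_ok S _) (backProd_step S p ω) fun n => by
      rw [Function.iterate_succ_apply, S.θ_left_inv]

theorem left_eigen (hc : Compatible S p) (hD : 1 ≤ D) (hg : GoodPoint S p D L ω)
    (hg' : GoodPoint S p D L (S.θ ω)) (j : ℕ) :
    ∑' i, leftVec S p ω i * entry p ω i j = eigenvalue S p ω * leftVec S p (S.θ ω) j := by
  have := (hg'.regular_backward hc hD).eigen_direction (hg.regular_backward hc hD)
    (baseLetter_ok S _) (baseLetter_ok S _) (backProd_step S p ω) j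
  simp only [mul_comm (leftVec S p ω _)]
  exact this

theorem right_eigen (hc : Compatible S p) (hD : 1 ≤ D) (hg : GoodPoint S p D L ω)
    (hg' : GoodPoint S p D L (S.θ ω)) (i : ℕ) :
    ∑' j, entry p ω i j * rightVec S p (S.θ ω) j = eigenvalue S p ω * rightVec S p ω i := by
  obtain ⟨c, hcdir⟩ : ∃ c : ENNReal, ∀ i,
      ∑' j, entry p ω i j * rightDir S p (S.θ ω) j = c * rightDir S p ω i :=
    ⟨_, (hg.regular_forward hc hD).eigen_direction (hg'.regular_forward hc hD)
      (baseLetter_ok S _) (baseLetter_ok S _) (eprod_succ' S p ω)⟩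
  have hs0 := hg.pairing_ne_zero hc hD
  have hs := hg.pairing_ne_top hc hD
  have hs0' := hg'.pairing_ne_zero hc hD
  have hs' := hg'.pairing_ne_top hc hD
  have hpair : eigenvalue S p ω * pairing S p (S.θ ω) = c * pairing S p ω := by
    rw [pairing, pairing, ← ENNReal.tsum_mul_left, ← ENNReal.tsum_mul_left]
    calc _ = ∑' j, ∑' i, leftVec S p ω i * entry p ω i j * rightDir S p (S.θ ω) j :=
          tsum_congr fun j => by
            rw [← mul_assoc, ← hg.left_eigen hc hD hg', ENNReal.tsum_mul_right]
      _ = ∑' i, ∑' j, leftVec S p ω i * entry p ω i j * rightDir S p (S.θ ω) j :=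
          ENNReal.tsum_comm
      _ = _ := tsum_congr fun i => by
            simp only [mul_assoc]
            rw [ENNReal.tsum_mul_left, hcdir]
            ring
  simp only [rightVec, div_eq_mul_inv, ← mul_assoc]
  rw [ENNReal.tsum_mul_right, hcdir]
  have : eigenvalue S p ω = c * pairing S p ω * (pairing S p (S.θ ω))⁻¹ := by
    rw [← hpair, mul_assoc, ENNReal.mul_inv_cancel hs0' hs', mul_one]
  rw [this]
  calc _ = c * (pairing S p ω * (pairing S p ω)⁻¹) * rightDir S p ω i *
        (pairing S p (S.θ ω))⁻¹ := by rw [ENNReal.mul_inv_cancel hs0 hs, mul_one]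
    _ = _ := by ring

end GoodPoint

section Convergence

variable {S : Chain Ω} {p : Ω → ℕ → ℕ → ℝ} {ω : Ω} {D L : ℕ}

theorem eigenvalue_iterate_ne_zero_ne_top (hc : Compatible S p) (hD : 1 ≤ D)
    (hg : ∀ n, GoodPoint S p D L (S.θ^[n] ω)) (n : ℕ) :
    eigenvalue S p (S.θ^[n] ω) ≠ 0 ∧ eigenvalue S p (S.θ^[n] ω) ≠ ⊤ := by
  have hg' := hg (n + 1)
  rw [Function.iterate_succ_apply'] at hg'
  exact (hg n).eigenvalue_ne_zero_ne_top hc hD hg'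

theorem left_eigen_iterate (hc : Compatible S p) (hD : 1 ≤ D)
    (hg : ∀ n, GoodPoint S p D L (S.θ^[n] ω)) (n j : ℕ) :
    ∑' i, leftVec S p ω i * eprod S p ω n i j =
      (∏ k ∈ Finset.range n, eigenvalue S p (S.θ^[k] ω)) * leftVec S p (S.θ^[n] ω) j := by
  induction n generalizing j with
  | zero => simp [eprod]
  | succ n ih =>
    have hg' := hg (n + 1)
    rw [Function.iterate_succ_apply'] at hg' ⊢
    rw [Finset.prod_range_succ, mul_assoc, ← (hg n).left_eigen hc hD hg', ← ENNReal.tsum_mul_left]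
    simp only [eprod, mm, ← ENNReal.tsum_mul_left]
    rw [ENNReal.tsum_comm]
    refine tsum_congr fun k => ?_
    rw [← mul_assoc, ← ih, ← ENNReal.tsum_mul_right]
    simp only [mul_assoc]

theorem right_eigen_iterate (hc : Compatible S p) (hD : 1 ≤ D)
    (hg : ∀ n, GoodPoint S p D L (S.θ^[n] ω)) (n i : ℕ) :
    ∑' j, eprod S p ω n i j * rightVec S p (S.θ^[n] ω) j =
      (∏ k ∈ Finset.range n, eigenvalue S p (S.θ^[k] ω)) * rightVec S p ω i := by
  induction n with
  | zero => simp [eprod]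
  | succ n ih =>
    have hg' := hg (n + 1)
    rw [Function.iterate_succ_apply'] at hg' ⊢
    rw [Finset.prod_range_succ, mul_right_comm, ← ih, ← ENNReal.tsum_mul_right]
    simp only [eprod, mm, ← ENNReal.tsum_mul_right]
    rw [ENNReal.tsum_comm]
    refine tsum_congr fun k => ?_
    rw [mul_assoc, mul_comm (rightVec _ _ _ _), ← (hg n).right_eigen hc hD hg',
      ← ENNReal.tsum_mul_left]
    simp only [mul_assoc]

theorem eventually_rank_one_bounds (hc : Compatible S p) (hD : 1 ≤ D)
    (hg : ∀ n, GoodPoint S p D L (S.θ^[n] ω)) {ε : ENNReal} (hε : ε ≠ 0) :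
    ∀ᶠ n in atTop, ∀ i j,
      (∏ k ∈ Finset.range n, eigenvalue S p (S.θ^[k] ω)) *
        (rightVec S p ω i * leftVec S p (S.θ^[n] ω) j) ≤ (1 + ε) * eprod S p ω n i j ∧
      eprod S p ω n i j ≤ (1 + ε) * ((∏ k ∈ Finset.range n, eigenvalue S p (S.θ^[k] ω)) *
        (rightVec S p ω i * leftVec S p (S.θ^[n] ω) j)) := by
  have hg0 : GoodPoint S p D L ω := hg 0
  filter_upwards [(hg0.regular_forward hc hD).cross ε hε] with n hn i j
  have hval := eigenvalue_iterate_ne_zero_ne_top hc hD hg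
  have hl := left_eigen_iterate hc hD hg n
  have hr := right_eigen_iterate hc hD hg n
  have hΛ0 : (∏ k ∈ Finset.range n, eigenvalue S p (S.θ^[k] ω)) ≠ 0 :=
    Finset.prod_ne_zero_iff.2 fun k _ => (hval k).1
  have hΛ : (∏ k ∈ Finset.range n, eigenvalue S p (S.θ^[k] ω)) ≠ ⊤ :=
    ENNReal.prod_ne_top fun k _ => (hval k).2
  set Λ := ∏ k ∈ Finset.range n, eigenvalue S p (S.θ^[k] ω)
  set Q := eprod S p ω n
  have htot : ∑' k, ∑' l, leftVec S p ω k * (Q k l * rightVec S p (S.θ^[n] ω) l) = Λ := by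
    simp only [ENNReal.tsum_mul_left, hr]
    calc _ = ∑' k, Λ * (leftVec S p ω k * rightVec S p ω k) := tsum_congr fun k => by ring
      _ = Λ := by rw [ENNReal.tsum_mul_left, hg0.tsum_leftVec_mul_rightVec hc hD, mul_one]
  have hrank : Λ * (Λ * (rightVec S p ω i * leftVec S p (S.θ^[n] ω) j)) =
      ∑' k, ∑' l, (leftVec S p ω k * rightVec S p (S.θ^[n] ω) l) * (Q k j * Q i l) := by
    calc _ = (Λ * leftVec S p (S.θ^[n] ω) j) * (Λ * rightVec S p ω i) := by ring
      _ = _ := by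
        rw [← hl, ← hr, ← ENNReal.tsum_mul_right]
        refine tsum_congr fun k => ?_
        rw [← ENNReal.tsum_mul_left]
        exact tsum_congr fun l => by ring
  have hentry : Λ * Q i j =
      ∑' k, ∑' l, (leftVec S p ω k * rightVec S p (S.θ^[n] ω) l) * (Q k l * Q i j) := by
    rw [← htot, ← ENNReal.tsum_mul_right]
    refine tsum_congr fun k => ?_
    rw [← ENNReal.tsum_mul_right]
    exact tsum_congr fun l => by ring
  constructor
  · rw [← ENNReal.mul_le_mul_iff_right hΛ0 hΛ, hrank, mul_left_comm, hentry,
      ← ENNReal.tsum_mul_left]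
    refine ENNReal.tsum_le_tsum fun k => ?_
    rw [← ENNReal.tsum_mul_left]
    refine ENNReal.tsum_le_tsum fun l => ?_
    rw [mul_left_comm (1 + ε)]
    exact mul_le_mul_right (hn k j i l) _
  · rw [← ENNReal.mul_le_mul_iff_right hΛ0 hΛ, mul_left_comm, hrank, hentry,
      ← ENNReal.tsum_mul_left]
    refine ENNReal.tsum_le_tsum fun k => ?_
    rw [← ENNReal.tsum_mul_left]
    refine ENNReal.tsum_le_tsum fun l => ?_
    rw [mul_left_comm (1 + ε)]
    exact mul_le_mul_right (hn k l i j) _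

theorem tendsto_rank_one (hc : Compatible S p) (hD : 1 ≤ D)
    (hg : ∀ n, GoodPoint S p D L (S.θ^[n] ω)) (i : ℕ) :
    Tendsto (fun n => ∑' j,
        |matProd S p ω n i j / Lam S (fun ω => (eigenvalue S p ω).toReal) ω n -
          (rightVec S p ω i).toReal * (leftVec S p (S.θ^[n] ω) j).toReal| *
            (rightVec S p (S.θ^[n] ω) j).toReal) atTop (𝓝 0) := by
  have hg0 : GoodPoint S p D L ω := hg 0
  have hcol : ∀ k, ColumnRegular S p (S.θ^[k] ω) := hg0.col 0
  set m := (rightVec S p ω i).toReal with hm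
  have bound : ∀ ε : NNReal, 0 < ε → ε ≤ 1 → ∀ᶠ n in atTop, ∑' j,
        |matProd S p ω n i j / Lam S (fun ω => (eigenvalue S p ω).toReal) ω n -
          m * (leftVec S p (S.θ^[n] ω) j).toReal| *
            (rightVec S p (S.θ^[n] ω) j).toReal ≤ 2 * ε * m := by
    intro ε hε hε1
    filter_upwards [eventually_rank_one_bounds hc hD hg (ε := ε)
      (by exact_mod_cast hε.ne')] with n hn
    have hval := eigenvalue_iterate_ne_zero_ne_top hc hD hg
    have hΛ : (∏ k ∈ Finset.range n, eigenvalue S p (S.θ^[k] ω)) ≠ ⊤ :=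
      ENNReal.prod_ne_top fun k _ => (hval k).2
    have hLam : Lam S (fun ω => (eigenvalue S p ω).toReal) ω n =
        (∏ k ∈ Finset.range n, eigenvalue S p (S.θ^[k] ω)).toReal := by
      rw [Lam, ENNReal.toReal_prod]
    have hLpos : 0 < Lam S (fun ω => (eigenvalue S p ω).toReal) ω n :=
      Finset.prod_pos fun k _ => ENNReal.toReal_pos (hval k).1 (hval k).2
    have hone := (hg n).tsum_leftVec_mul_rightVec hc hD
    have hsum : HasSum (fun j => (leftVec S p (S.θ^[n] ω) j).toReal *
        (rightVec S p (S.θ^[n] ω) j).toReal) 1 := by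
      have := ENNReal.hasSum_toReal (f := fun j => leftVec S p (S.θ^[n] ω) j *
        rightVec S p (S.θ^[n] ω) j) (by rw [hone]; exact ENNReal.one_ne_top)
      rw [← ENNReal.tsum_toReal_eq fun j => ENNReal.mul_ne_top ((hg n).leftVec_ne_top hc hD j)
        ((hg n).rightVec_ne_top hc hD j), hone] at this
      simpa using this
    have hm0 : 0 ≤ m := ENNReal.toReal_nonneg
    have hterm : ∀ j, |matProd S p ω n i j / Lam S (fun ω => (eigenvalue S p ω).toReal) ω n -
          m * (leftVec S p (S.θ^[n] ω) j).toReal| * (rightVec S p (S.θ^[n] ω) j).toReal ≤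
        2 * ε * m * ((leftVec S p (S.θ^[n] ω) j).toReal *
          (rightVec S p (S.θ^[n] ω) j).toReal) := by
      intro j
      obtain ⟨h1, h2⟩ := hn i j
      have e1 : (1 + ε : ENNReal) ≠ ⊤ := by simp
      have e2 := eprod_ne_top hcol n i j
      have e3 := (hg n).leftVec_ne_top hc hD j
      have e4 := hg0.rightVec_ne_top hc hD i
      have h1' := ENNReal.toReal_mono (ENNReal.mul_ne_top e1 e2) h1
      have h2' := ENNReal.toReal_mono (ENNReal.mul_ne_top e1
        (ENNReal.mul_ne_top hΛ (ENNReal.mul_ne_top e4 e3))) h2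
      have e5 : (1 + ε : ENNReal).toReal = 1 + ε := by
        rw [ENNReal.toReal_add ENNReal.one_ne_top ENNReal.coe_ne_top]
        simp
      simp only [ENNReal.toReal_mul, e5, ← hLam, ← hm] at h1' h2'
      rw [matProd_eq_toReal hc hcol]
      have hl0 : 0 ≤ (leftVec S p (S.θ^[n] ω) j).toReal := ENNReal.toReal_nonneg
      have hr0 : 0 ≤ (rightVec S p (S.θ^[n] ω) j).toReal := ENNReal.toReal_nonneg
      set a := (leftVec S p (S.θ^[n] ω) j).toReal
      set Λ := Lam S (fun ω => (eigenvalue S p ω).toReal) ω n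
      set x := (eprod S p ω n i j).toReal
      have hx1 : m * a ≤ (1 + ε) * (x / Λ) := by
        rw [← mul_div_assoc, le_div_iff₀ hLpos]
        linarith
      have hx2 : x / Λ ≤ (1 + ε) * (m * a) := by
        rw [div_le_iff₀ hLpos]
        linarith
      have hε0 : (0 : ℝ) < ε := hε
      have hε1' : (ε : ℝ) ≤ 1 := hε1
      have hma : 0 ≤ m * a := mul_nonneg hm0 hl0
      have : |x / Λ - m * a| ≤ 2 * ε * m * a := by
        rw [abs_le]
        constructor
        · have : x / Λ ≤ 2 * (m * a) := by nlinarith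
          nlinarith
        · nlinarith
      calc _ ≤ 2 * ε * m * a * (rightVec S p (S.θ^[n] ω) j).toReal := by gcongr
        _ = _ := by ring
    have hs := hsum.mul_left (2 * ε * m)
    rw [mul_one] at hs
    refine (Summable.tsum_le_tsum hterm (Summable.of_nonneg_of_le (fun j => by positivity) hterm
      hs.summable) hs.summable).trans hs.tsum_eq.le
  rw [Metric.tendsto_atTop']
  intro δ hδ
  have hm0 : 0 ≤ m := ENNReal.toReal_nonneg
  set ε : ℝ := min 1 (δ / (2 * (m + 1)) / 2)
  have hε : 0 < ε := by positivity
  have hb := bound ⟨ε, hε.le⟩ hε (show ε ≤ 1 from min_le_left _ _)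
  obtain ⟨N, hN⟩ := eventually_atTop.1 hb
  refine ⟨N, fun n hn => ?_⟩
  rw [Real.dist_0_eq_abs, abs_of_nonneg (tsum_nonneg fun j => by positivity)]
  refine (hN n hn.le).trans_lt ?_
  have h2 : ε ≤ δ / (2 * (m + 1)) / 2 := min_le_right _ _
  have h3 : δ / (2 * (m + 1)) / 2 * (4 * (m + 1)) = δ := by field_simp; ring
  change 2 * ε * m < δ
  nlinarith

end Convergence

section Blocks

variable {S : Chain Ω} {p : Ω → ℕ → ℕ → ℝ} {ω : Ω}

/-- All nonzero entries in a row of the matrix at `ω` are comparable, uniformly over the rows. -/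
def RowRatioBounded (p : Ω → ℕ → ℕ → ℝ) (ω : Ω) : Prop :=
  ∃ C : ℕ, ∀ i j k : ℕ, p ω i k ≠ 0 → p ω i j ≤ C * p ω i k

theorem RowRatioBounded.entry_le {α : Type*} {p : α → ℕ → ℕ → ℝ} {ω : α}
    (h : RowRatioBounded p ω) :
    ∃ C : ENNReal, C ≠ 0 ∧ C ≠ ⊤ ∧
      ∀ i j k, entry p ω i k ≠ 0 → entry p ω i j ≤ C * entry p ω i k := by
  obtain ⟨C, hC⟩ := h
  refine ⟨(C : ENNReal) + 1, by simp, by simp, fun i j k hk => ?_⟩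
  have hpos := entry_ne_zero_iff.1 hk
  calc entry p ω i j ≤ ENNReal.ofReal (C * p ω i k) := ENNReal.ofReal_le_ofReal (hC i j k hpos.ne')
    _ = C * entry p ω i k := by rw [ENNReal.ofReal_mul (by positivity), entry, ENNReal.ofReal_natCast]
    _ ≤ _ := by gcongr; exact le_self_add

theorem exists_crossRatioLE_of_comparable {R : ℕ → ℕ → ENNReal} {ok : ℕ → Prop} {r : ℕ → ENNReal}
    {c K : ENNReal} (hc0 : c ≠ 0) (hc : c ≠ ⊤) (hK : K ≠ ⊤) (hzero : ∀ i j, ¬ ok j → R i j = 0)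
    (hle : ∀ i j, R i j ≤ K * r i) (hge : ∀ i j, ok j → c * r i ≤ R i j) :
    ∃ D : ℕ, 1 ≤ D ∧ CrossRatioLE D R := by
  obtain ⟨D, hD⟩ := ENNReal.exists_nat_gt
    (ENNReal.mul_ne_top (ENNReal.div_ne_top hK hc0) (ENNReal.div_ne_top hK hc0))
  refine ⟨D + 1, by omega, CrossRatioLE.mono (hD.le.trans (by simp)) fun i j k l => ?_⟩
  by_cases hj : ok j
  · by_cases hl : ok l
    · calc R i j * R k l ≤ (K * r i) * (K * r k) := mul_le_mul' (hle i j) (hle k l)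
        _ = (K / c * (c * r i)) * (K / c * (c * r k)) := by
          rw [← mul_assoc (K / c), ← mul_assoc (K / c), ENNReal.div_mul_cancel hc0 hc]
        _ = K / c * (K / c) * ((c * r i) * (c * r k)) := by ring
        _ ≤ _ := mul_le_mul_right (mul_le_mul' (hge i l hl) (hge k j hj)) _
    · simp [hzero k l hl]
  · simp [hzero i j hj]

/-- A big image, a mixing stretch and a big preimage together form a block. -/
theorem exists_isBlock (hc : Compatible S p) (hcol : ∀ k, ColumnRegular S p (S.θ^[k] ω))
    (hratio : RowRatioBounded p ω) {I J : Finset ℕ} {n : ℕ}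
    (hI : ∀ a, S.letterOK ω a = true → ∃ b ∈ I, entry p ω a b ≠ 0)
    (hratio' : RowRatioBounded p (S.θ^[n] (S.θ ω)))
    (hJ : ∀ a, S.letterOK (S.θ^[n + 1] (S.θ ω)) a = true →
      ∃ b ∈ J, entry p (S.θ^[n] (S.θ ω)) b a ≠ 0)
    (hIJ : ∀ b ∈ I, ∀ b' ∈ J, eprod S p (S.θ ω) n b b' ≠ 0) :
    ∃ D : ℕ, 1 ≤ D ∧ IsBlock S p D (n + 2) ω := by
  obtain ⟨C, hC0, hC, hrow⟩ := hratio.entry_le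
  obtain ⟨C', hC0', hC', hrow'⟩ := hratio'.entry_le
  have hcol' : ∀ k, ColumnRegular S p (S.θ^[k] (S.θ ω)) := fun k => hcol (k + 1)
  obtain ⟨M, hM, hMle⟩ := eprod_column_sum_le hcol' (n + 1)
  have hd : ∀ b, ∃ d : ENNReal, d ≠ 0 ∧
      ∀ j, entry p (S.θ^[n] (S.θ ω)) b j ≠ 0 → d ≤ entry p (S.θ^[n] (S.θ ω)) b j := by
    intro b
    by_cases h : ∃ k, entry p (S.θ^[n] (S.θ ω)) b k ≠ 0
    · obtain ⟨k, hk⟩ := h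
      refine ⟨entry p (S.θ^[n] (S.θ ω)) b k / C', ENNReal.div_ne_zero.2 ⟨hk, hC'⟩, fun j hj => ?_⟩
      exact ENNReal.div_le_of_le_mul' (hrow' b k j hj)
    · push Not at h
      exact ⟨1, one_ne_zero, fun j hj => absurd (h j) hj⟩
  choose d hd0 hd using hd
  obtain ⟨c, hc0, hctop, hcle⟩ : ∃ c : ENNReal, c ≠ 0 ∧ c ≠ ⊤ ∧ ∀ b ∈ I, ∀ j,
      S.letterOK (S.θ^[n + 1] (S.θ ω)) j = true → c ≤ eprod S p (S.θ ω) (n + 1) b j := by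
    refine ⟨min 1 ((I ×ˢ J).inf fun x => eprod S p (S.θ ω) n x.1 x.2 * d x.2), ?_, ?_, ?_⟩
    · rw [← pos_iff_ne_zero, lt_min_iff, Finset.lt_inf_iff ENNReal.zero_lt_top]
      refine ⟨one_pos, fun x hx => pos_iff_ne_zero.2 ?_⟩
      rw [Finset.mem_product] at hx
      exact mul_ne_zero (hIJ _ hx.1 _ hx.2) (hd0 _)
    · exact ne_top_of_le_ne_top ENNReal.one_ne_top (min_le_left _ _)
    · intro b hb j hj
      obtain ⟨b', hb', hbj⟩ := hJ j hj
      refine (min_le_right _ _).trans ((Finset.inf_le (b := (b, b'))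
        (Finset.mem_product.2 ⟨hb, hb'⟩)).trans ?_)
      refine (mul_le_mul_right (hd b' j hbj) _).trans ?_
      exact ENNReal.le_tsum (f := fun k => eprod S p (S.θ ω) n b k *
        entry p (S.θ^[n] (S.θ ω)) k j) b'
  have hsplit : eprod S p ω (n + 2) = mm (entry p ω) (eprod S p (S.θ ω) (n + 1)) :=
    eprod_succ' S p ω (n + 1)
  have hr : ∀ a, ∃ r : ENNReal, (∀ j, eprod S p ω (n + 2) a j ≤ C * M * r) ∧
      (∀ j, S.letterOK (S.θ^[n + 2] ω) j = true → c * r ≤ eprod S p ω (n + 2) a j) ∧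
      (S.letterOK ω a = true → r ≠ 0) := by
    intro a
    by_cases ha : S.letterOK ω a = true
    · obtain ⟨b, hb, hab⟩ := hI a ha
      refine ⟨entry p ω a b, fun j => ?_, fun j hj => ?_, fun _ => hab⟩
      · rw [hsplit, mm]
        calc _ ≤ ∑' k, C * entry p ω a b * eprod S p (S.θ ω) (n + 1) k j :=
              ENNReal.tsum_le_tsum fun k => mul_le_mul_left (hrow a k b hab) _
          _ ≤ C * entry p ω a b * M := by
              rw [ENNReal.tsum_mul_left]
              exact mul_le_mul_right (hMle j) _
          _ = _ := by ring
      · rw [hsplit, mm, mul_comm]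
        exact (mul_le_mul_right (hcle b hb j hj) _).trans
          (ENNReal.le_tsum (f := fun k => entry p ω a k * eprod S p (S.θ ω) (n + 1) k j) b)
    · refine ⟨0, fun j => ?_, fun j _ => by simp, fun h => absurd h ha⟩
      rw [hc.eprod_eq_zero_left (by omega) ha]
      exact zero_le
  choose r hr1 hr2 hr3 using hr
  obtain ⟨D, hD, hcr⟩ := exists_crossRatioLE_of_comparable hc0 hctop (ENNReal.mul_ne_top hC hM)
    (fun i j hj => hc.eprod_eq_zero_right (by omega) hj i) hr1 hr2
  refine ⟨D, hD, hcr, fun i j hi hj h0 => ?_⟩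
  have := hr2 i j hj
  rw [h0, nonpos_iff_eq_zero] at this
  exact mul_ne_zero hc0 (hr3 i hi) this

theorem Compatible.eprod_ne_zero_of_mem_fiber (hc : Compatible S p) {x : ℕ → ℕ}
    (hx : x ∈ fiber S ω) (n : ℕ) : eprod S p ω n (x 0) (x n) ≠ 0 := by
  induction n with
  | zero => simp [eprod]
  | succ n ih =>
    refine mm_ne_zero ih (entry_ne_zero_iff.2 ((hc.sgn _ _ _ (hx n).1 ?_).1 (hx n).2))
    rw [← Function.iterate_succ_apply' S.θ]
    exact (hx (n + 1)).1

theorem mem_OmegaW_of_letterOK {a : ℕ} (ha : S.letterOK ω a = true) : ω ∈ OmegaW S [a] := by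
  have hnext : ∀ n (i : {i // S.letterOK (S.θ^[n] ω) i = true}),
      ∃ j : {j // S.letterOK (S.θ^[n + 1] ω) j = true}, S.tr (S.θ^[n] ω) i j = true := by
    rintro n ⟨i, hi⟩
    obtain ⟨j, hj, hij⟩ := S.no_zero_row _ i hi
    exact ⟨⟨j, by rwa [Function.iterate_succ_apply']⟩, hij⟩
  choose next hnext using hnext
  let x : ∀ n, {i // S.letterOK (S.θ^[n] ω) i = true} := fun n =>
    Nat.rec (motive := fun n => {i // S.letterOK (S.θ^[n] ω) i = true}) ⟨a, ha⟩ next n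
  refine ⟨fun n => x n, fun n => ⟨(x n).2, hnext n (x n)⟩, fun i hi => ?_⟩
  have : i = 0 := by simpa using hi
  subst this
  rfl

end Blocks

section Recurrence

theorem ae_frequently_mem {P : Measure Ω} [IsProbabilityMeasure P] {f : Ω → Ω} (hf : Ergodic f P)
    {s : Set Ω} (hs : MeasurableSet s) (h0 : P s ≠ 0) :
    ∀ᵐ ω ∂P, ∃ᶠ n in atTop, f^[n] ω ∈ s := by
  have hmeas : MeasurableSet {ω | ∃ᶠ n in atTop, f^[n] ω ∈ s} := by
    simp only [frequently_atTop, Set.ofPred_forall, Set.ofPred_exists, Set.ofPred_and]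
    refine MeasurableSet.iInter fun N => MeasurableSet.iUnion fun n => ?_
    exact (MeasurableSet.const _).inter (hf.measurable.iterate n hs)
  have hinv : f ⁻¹' {ω | ∃ᶠ n in atTop, f^[n] ω ∈ s} = {ω | ∃ᶠ n in atTop, f^[n] ω ∈ s} := by
    ext ω
    simp only [Set.mem_preimage, Set.mem_ofPred_eq, ← Function.iterate_succ_apply]
    conv_rhs => rw [← map_add_atTop_eq_nat 1, frequently_map]
  rcases hf.toPreErgodic.ae_mem_or_ae_notMem hmeas hinv with h | h
  · exact h
  · refine absurd ?_ h0
    have hrec := hf.toMeasurePreserving.conservative.ae_mem_imp_frequently_image_mem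
      hs.nullMeasurableSet
    refine measure_mono_null (fun ω hω => ?_) (ae_iff.1 (hrec.and h))
    intro hcon
    exact hcon.2 (hcon.1 hω)

theorem ergodic_θinv {P : Measure Ω} {S : Chain Ω} (hθ : Ergodic S.θ P) : Ergodic S.θinv P := by
  let e : Ω ≃ᵐ Ω := ⟨⟨S.θ, S.θinv, S.θ_left_inv, S.θ_right_inv⟩, S.θ_meas, S.θinv_meas⟩
  have he : Ergodic e P := hθ
  exact he.symm

end Recurrence

section Measurability

variable {S : Chain Ω} {p : Ω → ℕ → ℕ → ℝ}

theorem measurable_eprod (hp : ∀ i j, Measurable fun ω => p ω i j) (n i j : ℕ) :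
    Measurable fun ω => eprod S p ω n i j := by
  induction n generalizing j with
  | zero => exact measurable_const
  | succ n ih =>
    simp only [eprod, mm]
    refine Measurable.tsum fun k => (ih k).mul ?_
    exact ((hp k j).comp (S.θ_meas.iterate n)).ennreal_ofReal

theorem measurableSet_letterOK (S : Chain Ω) (i : ℕ) :
    MeasurableSet {ω | S.letterOK ω i = true} :=
  S.letterOK_meas i (MeasurableSet.singleton true)

theorem measurableSet_isBlock (hp : ∀ i j, Measurable fun ω => p ω i j) (D L : ℕ) :
    MeasurableSet {ω | IsBlock S p D L ω} := by
  refine MeasurableSet.inter ?_ ?_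
  · refine measurableSet_setOfPred.2 (Measurable.forall fun i => Measurable.forall fun j =>
      Measurable.forall fun k => Measurable.forall fun l =>
        measurableSet_setOfPred.1 (measurableSet_le ?_ ?_))
    · exact (measurable_eprod hp _ _ _).mul (measurable_eprod hp _ _ _)
    · exact ((measurable_eprod hp _ _ _).mul (measurable_eprod hp _ _ _)).const_mul _
  · refine measurableSet_setOfPred.2 (Measurable.forall fun i => Measurable.forall fun j =>
      (measurableSet_setOfPred.1 (measurableSet_letterOK S i)).imp
        ((measurableSet_setOfPred.1 (S.θ_meas.iterate L (measurableSet_letterOK S j))).imp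
          (measurableSet_setOfPred.1 ?_)))
    exact (measurable_eprod hp L i j (MeasurableSet.singleton 0)).compl

theorem measurableSet_rowRatioBounded (hp : ∀ i j, Measurable fun ω => p ω i j) :
    MeasurableSet {ω | RowRatioBounded p ω} :=
  measurableSet_setOfPred.2 (Measurable.exists fun _ => Measurable.forall fun i =>
    Measurable.forall fun j => Measurable.forall fun k =>
      (measurableSet_setOfPred.1 (hp i k (MeasurableSet.singleton 0)).compl).imp
        (measurableSet_setOfPred.1 (measurableSet_le (hp i j) ((hp i k).const_mul _))))

/-- The points at which the preimage `J` is big and the preceding rows have bounded ratios. -/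
def bigPreSet (S : Chain Ω) (p : Ω → ℕ → ℕ → ℝ) (J : Finset ℕ) : Set Ω :=
  {ω | (∀ b ∈ J, S.letterOK (S.θinv ω) b = true) ∧
    (∀ a, S.letterOK ω a = true → ∃ b ∈ J, S.tr (S.θinv ω) b a = true) ∧
    RowRatioBounded p (S.θinv ω)}

theorem measurableSet_bigPreSet (hp : ∀ i j, Measurable fun ω => p ω i j) (J : Finset ℕ) :
    MeasurableSet (bigPreSet S p J) := by
  refine MeasurableSet.inter ?_ (MeasurableSet.inter ?_ ?_)
  · exact measurableSet_setOfPred.2 (Measurable.forall fun b => measurable_const.imp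
      (measurableSet_setOfPred.1 (S.θinv_meas (measurableSet_letterOK S b))))
  · refine measurableSet_setOfPred.2 (Measurable.forall fun a =>
      (measurableSet_setOfPred.1 (measurableSet_letterOK S a)).imp (Measurable.exists fun b =>
        measurable_const.and (measurableSet_setOfPred.1 ?_)))
    exact (S.tr_meas b a).comp S.θinv_meas (MeasurableSet.singleton true)
  · exact S.θinv_meas (measurableSet_rowRatioBounded hp)

end Measurability

section AlmostSure

variable {S : Chain Ω} {p : Ω → ℕ → ℕ → ℝ} {P : Measure Ω}

theorem columnRegular_of_sum_bounds (hc : Compatible S p) {ω : Ω} {m M : ℝ} (hm : 0 < m)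
    (h : ∀ j, S.letterOK (S.θ ω) j = true →
      Summable (fun i => p ω i j) ∧ m ≤ ∑' i, p ω i j ∧ (∑' i, p ω i j) ≤ M) :
    ColumnRegular S p ω := by
  refine ⟨⟨ENNReal.ofReal M, ENNReal.ofReal_ne_top, fun j => ?_⟩, fun j hj => ?_⟩
  · by_cases hj : S.letterOK (S.θ ω) j = true
    · obtain ⟨hs, -, hM⟩ := h j hj
      simp only [entry]
      rw [← ENNReal.ofReal_tsum_of_nonneg (fun i => hc.nonneg ω i j) hs]
      exact ENNReal.ofReal_le_ofReal hM
    · simp [entry, hc.range ω _ j fun hij => hj hij.2]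
  · by_contra hcon
    push Not at hcon
    have hzero : ∀ i, p ω i j = 0 := fun i =>
      le_antisymm (ENNReal.ofReal_eq_zero.1 (hcon i)) (hc.nonneg ω i j)
    have := (h j hj).2.1
    simp only [hzero, tsum_zero] at this
    exact this.not_gt hm

theorem ae_forall_iterate {f : Ω → Ω} (hf : MeasurePreserving f P P) {q : Ω → Prop}
    (hq : ∀ᵐ ω ∂P, q ω) : ∀ᵐ ω ∂P, ∀ n, q (f^[n] ω) :=
  ae_all_iff.2 fun n => (hf.iterate n).quasiMeasurePreserving.ae hq

theorem ae_letter_pos (S : Chain Ω) (P : Measure Ω) :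
    ∀ᵐ ω ∂P, ∀ a, S.letterOK ω a = true → 0 < P (OmegaW S [a]) := by
  refine ae_all_iff.2 fun a => ?_
  by_cases h : P (OmegaW S [a]) = 0
  · filter_upwards [measure_eq_zero_iff_ae_notMem.1 h] with ω hω ha
    exact absurd (mem_OmegaW_of_letterOK ha) hω
  · exact Eventually.of_forall fun _ _ => pos_iff_ne_zero.2 h

theorem wordAdm_singleton {ω : Ω} {a : ℕ} : wordAdm S ω [a] ↔ S.letterOK ω a = true := by
  simp [wordAdm]

theorem tr_of_wordAdm_pair {ω : Ω} {a b : ℕ} (h : wordAdm S ω [a, b]) : S.tr ω a b = true :=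
  h.2 0 (by simp)

theorem exists_bigPreSet_ne_zero {Ωbp : Set Ω} (hbp : BigPre S P Ωbp)
    (hratio : ∀ᵐ ω ∂P, ω ∈ Ωbp → RowRatioBounded p (S.θinv ω)) :
    ∃ J, P (bigPreSet S p J) ≠ 0 := by
  by_contra! hcon
  refine hbp.1.ne' (measure_mono_null_ae ?_ (measure_iUnion_null hcon))
  filter_upwards [hratio] with ω hω hmem
  obtain ⟨J, hJ, hpre⟩ := hbp.2 ω hmem
  refine Set.mem_iUnion.2 ⟨J, fun b hb => wordAdm_singleton.1 (hJ b hb), fun a ha => ?_, hω hmem⟩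
  obtain ⟨b, hb, hba⟩ := hpre a (wordAdm_singleton.2 ha)
  exact ⟨b, hb, tr_of_wordAdm_pair hba⟩

/-- A point of big images, followed by a recurrent visit to a set of big preimages, starts a
block. -/
theorem exists_isBlock_of_big_images (hc : Compatible S p) (hmix : TopMix S P) {ω : Ω}
    (hcol : ∀ k, ColumnRegular S p (S.θ^[k] (S.θinv ω)))
    (hratio : RowRatioBounded p (S.θinv ω))
    (hpos : ∀ n a, S.letterOK (S.θ^[n] ω) a = true → 0 < P (OmegaW S [a]))
    {I J : Finset ℕ} (hI : ∀ b ∈ I, wordAdm S ω [b])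
    (himage : ∀ a, wordAdm S (S.θinv ω) [a] → ∃ b ∈ I, wordAdm S (S.θinv ω) [a, b])
    (hJ : ∃ᶠ n in atTop, S.θ^[n] ω ∈ bigPreSet S p J) :
    ∃ D L : ℕ, 1 ≤ D ∧ IsBlock S p D L (S.θinv ω) := by
  have hθω : S.θ (S.θinv ω) = ω := S.θ_right_inv ω
  have hback : ∀ n, S.θinv (S.θ^[n + 1] ω) = S.θ^[n] ω := fun n => by
    rw [Function.iterate_succ_apply', S.θ_left_inv]
  have hN : ∀ b b', ∃ N : ℕ, 0 < P (OmegaW S [b]) → 0 < P (OmegaW S [b']) →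
      ∀ n, N ≤ n → S.letterOK ω b = true → S.letterOK (S.θ^[n] ω) b' = true →
        eprod S p ω n b b' ≠ 0 := by
    intro b b'
    by_cases h : 0 < P (OmegaW S [b]) ∧ 0 < P (OmegaW S [b'])
    · obtain ⟨N, -, hN⟩ := hmix b b' h.1 h.2
      refine ⟨N ω, fun _ _ n hn hb hb' => ?_⟩
      obtain ⟨x, hx, hx'⟩ := hN ω n hn (wordAdm_singleton.2 hb) (mem_OmegaW_of_letterOK hb')
      have h0 : x 0 = b := hx.2 0 (by simp)
      have hn' : x n = b' := by simpa [shiftIt] using hx'.2 0 (by simp)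
      rw [← h0, ← hn']
      exact hc.eprod_ne_zero_of_mem_fiber hx.1 n
    · exact ⟨0, fun hb hb' => absurd ⟨hb, hb'⟩ h⟩
  choose N hN using hN
  obtain ⟨t, ht, htJ⟩ := frequently_atTop.1 hJ ((I ×ˢ J).sup (fun x => N x.1 x.2) + 1)
  obtain ⟨n, rfl⟩ : ∃ n, t = n + 1 := ⟨t - 1, by omega⟩
  obtain ⟨hJok, hJpre, hJratio⟩ := htJ
  rw [hback] at hJok hJratio
  suffices h : ∃ D : ℕ, 1 ≤ D ∧ IsBlock S p D (n + 2) (S.θinv ω) from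
    h.imp fun D hD => ⟨n + 2, hD⟩
  refine exists_isBlock (I := I) (J := J) hc hcol hratio
    (fun a ha => ?_) (by rwa [hθω]) (fun a ha => ?_) (fun b hb b' hb' => ?_)
  · obtain ⟨b, hb, hab⟩ := himage a (wordAdm_singleton.2 ha)
    refine ⟨b, hb, entry_ne_zero_iff.2 ((hc.sgn _ _ _ ha ?_).1 (tr_of_wordAdm_pair hab))⟩
    rw [hθω]
    exact wordAdm_singleton.1 (hI b hb)
  · rw [hθω] at ha ⊢
    obtain ⟨b, hb, hba⟩ := hJpre a ha
    rw [hback] at hba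
    refine ⟨b, hb, entry_ne_zero_iff.2 ((hc.sgn _ _ _ (hJok b hb) ?_).1 hba)⟩
    rwa [← Function.iterate_succ_apply' S.θ]
  · rw [hθω]
    have hbok := wordAdm_singleton.1 (hI b hb)
    refine hN b b' (hpos 0 b hbok) (hpos n b' (hJok b' hb')) n ?_ hbok (hJok b' hb')
    have := Finset.le_sup (f := fun x : ℕ × ℕ => N x.1 x.2) (Finset.mk_mem_product hb hb')
    simp only at this
    omega

theorem exists_ae_goodPoint [IsProbabilityMeasure P] (hθ : Ergodic S.θ P) (hc : Compatible S p)
    (hp : ∀ i j, Measurable fun ω => p ω i j) (hmix : TopMix S P) {Ωbi Ωbp : Set Ω}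
    (hbi : BigIm S P Ωbi) (hbp : BigPre S P Ωbp)
    (hratio : ∀ᵐ ω ∂P, S.θ ω ∈ Ωbi ∪ Ωbp → RowRatioBounded p ω)
    (hcol : ∀ᵐ ω ∂P, ColumnRegular S p ω) :
    ∃ D L : ℕ, 1 ≤ D ∧ ∀ᵐ ω ∂P, GoodPoint S p D L ω := by
  have hθi := ergodic_θinv hθ
  have hcol' : ∀ᵐ ω ∂P, ∀ n k, ColumnRegular S p (S.θ^[k] (S.θinv^[n] ω)) :=
    ae_forall_iterate hθi.toMeasurePreserving (ae_forall_iterate hθ.toMeasurePreserving hcol)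
  have hratio' : ∀ᵐ ω ∂P, ω ∈ Ωbi ∪ Ωbp → RowRatioBounded p (S.θinv ω) := by
    filter_upwards [hθi.toMeasurePreserving.quasiMeasurePreserving.ae hratio] with ω h hω
    exact h (by rwa [S.θ_right_inv])
  obtain ⟨J, hJ⟩ := exists_bigPreSet_ne_zero hbp
    (hratio'.mono fun ω h hω => h (Or.inr hω))
  have hpos := ae_forall_iterate hθ.toMeasurePreserving (ae_letter_pos S P)
  obtain ⟨D, L, hD, hDL⟩ : ∃ D L : ℕ, 1 ≤ D ∧ P {ω | IsBlock S p D L ω} ≠ 0 := by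
    by_contra! hcon
    have hnull : ∀ᵐ ω ∂P, ∀ D L : ℕ, 1 ≤ D → ¬ IsBlock S p D L ω :=
      ae_all_iff.2 fun D => ae_all_iff.2 fun L => by
        by_cases hD : 1 ≤ D
        · exact (measure_eq_zero_iff_ae_notMem.1 (hcon D L hD)).mono fun ω hω _ => hω
        · exact Eventually.of_forall fun ω h => absurd h hD
    refine hbi.1.ne' (measure_eq_zero_iff_ae_notMem.2 ?_)
    filter_upwards [hθi.toMeasurePreserving.quasiMeasurePreserving.ae hnull, hcol', hratio', hpos,
      ae_frequently_mem hθ (measurableSet_bigPreSet hp J) hJ] with ω hno hcolω hratioω hposω hfreq hω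
    obtain ⟨I, hI, himage⟩ := hbi.2 ω hω
    obtain ⟨D, L, hD, hblock⟩ := exists_isBlock_of_big_images hc hmix (hcolω 1)
      (hratioω (Or.inl hω)) hposω hI himage hfreq
    exact hno D L hD hblock
  refine ⟨D, L, hD, ?_⟩
  filter_upwards [hcol', ae_frequently_mem hθ (measurableSet_isBlock hp D L) hDL,
    ae_frequently_mem hθi (measurableSet_isBlock hp D L) hDL] with ω h1 h2 h3
  exact ⟨h1, h2, h3⟩

theorem toReal_entry (hc : Compatible S p) (ω : Ω) (i j : ℕ) : (entry p ω i j).toReal = p ω i j :=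
  ENNReal.toReal_ofReal (hc.nonneg ω i j)

end AlmostSure

/-- Corollary 4.6: the random Perron–Frobenius theorem for a
summable random matrix `A = (p^ω_{ij})` with the b.i.p.-property.  The chain
`S` is the random topological Markov chain given by the signum of `A`. -/
theorem random_perron_frobenius
    {Ω : Type*} [MeasurableSpace Ω] (P : Measure Ω) [IsProbabilityMeasure P]
    (S : Chain Ω) (hθ : Ergodic S.θ P)
    (p : Ω → ℕ → ℕ → ℝ)
    (hp_meas : ∀ i j, Measurable fun ω => p ω i j)
    (hp_nonneg : ∀ ω i j, 0 ≤ p ω i j)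
    (hp_range : ∀ ω i j,
      ¬(S.letterOK ω i = true ∧ S.letterOK (S.θ ω) j = true) → p ω i j = 0)
    -- (i) the signum of `A` is the transition structure of the chain `S`,
    -- which has the b.i.p.-property:
    (hsgn : ∀ ω i j, S.letterOK ω i = true → S.letterOK (S.θ ω) j = true →
      (S.tr ω i j = true ↔ 0 < p ω i j))
    (Ωbi Ωbp : Set Ω)
    (hmix : TopMix S P) (hbi : BigIm S P Ωbi) (hbp : BigPre S P Ωbp)
    -- (ii) bounded ratios within rows:
    (hratio : ∀ᵐ ω ∂P, S.θ ω ∈ Ωbi ∪ Ωbp → ∃ C : ℝ,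
      ∀ i j k : ℕ, p ω i k ≠ 0 → p ω i j ≤ C * p ω i k)
    -- (iii) summability: the column sums lie between `m_ω` and `M_ω`:
    (mS MS : Ω → ℝ) (hmS_pos : ∀ ω, 0 < mS ω) (hMS_pos : ∀ ω, 0 < MS ω)
    (hmS_int : Integrable (fun ω => Real.log (mS ω)) P)
    (hMS_int : Integrable (fun ω => Real.log (MS ω)) P)
    (hcol : ∀ᵐ ω ∂P, ∀ j, S.letterOK (S.θ ω) j = true →
      Summable (fun i => p ω i j) ∧
      mS ω ≤ ∑' i, p ω i j ∧ (∑' i, p ω i j) ≤ MS ω) :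
    ∃ lam : Ω → ℝ, ∃ h mu : Ω → ℕ → ℝ,
      (∀ ω i, S.letterOK ω i ≠ true → h ω i = 0 ∧ mu ω i = 0) ∧
      (∀ᵐ ω ∂P, 0 < lam ω) ∧
      (∀ᵐ ω ∂P, ∀ i, S.letterOK ω i = true → 0 < h ω i ∧ 0 < mu ω i) ∧
      (∀ᵐ ω ∂P,
        (∀ j, S.letterOK (S.θ ω) j = true →
          (∑' i, h ω i * p ω i j) = lam ω * h (S.θ ω) j) ∧
        (∀ i, S.letterOK ω i = true →
          (∑' j, p ω i j * mu (S.θ ω) j) = lam ω * mu ω i) ∧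
        (∑' i, h ω i * mu ω i) = 1) ∧
      (∀ᵐ ω ∂P, ∀ i, S.letterOK ω i = true →
        Tendsto (fun n => ∑' j,
            |matProd S p ω n i j / Lam S lam ω n - mu ω i * h (S.θ^[n] ω) j| *
              mu (S.θ^[n] ω) j)
          atTop (𝓝 0)) := by

  have hc : Compatible S p := ⟨hp_nonneg, hp_range, hsgn⟩
  obtain ⟨D, L, hD, hgood⟩ := exists_ae_goodPoint hθ hc hp_meas hmix hbi hbp
    (hratio.mono fun ω h hω => by
      obtain ⟨C, hC⟩ := h hω
      refine ⟨⌈C⌉₊, fun i j k hk => (hC i j k hk).trans ?_⟩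
      exact mul_le_mul_of_nonneg_right (Nat.le_ceil C) (hp_nonneg ω i k))
    (hcol.mono fun ω h => columnRegular_of_sum_bounds hc (hmS_pos ω) h)
  have hall := ae_forall_iterate hθ.toMeasurePreserving hgood
  refine ⟨fun ω => (eigenvalue S p ω).toReal, fun ω i => (leftVec S p ω i).toReal,
    fun ω i => (rightVec S p ω i).toReal, fun ω i hi => ?_, ?_, ?_, ?_, ?_⟩
  · simp [hc.leftVec_eq_zero hi, hc.rightVec_eq_zero hi]
  · filter_upwards [hall] with ω hg
    obtain ⟨h0, htop⟩ := GoodPoint.eigenvalue_ne_zero_ne_top hc hD (hg 0) (hg 1)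
    exact ENNReal.toReal_pos h0 htop
  · filter_upwards [hgood] with ω hg i hi
    exact ⟨ENNReal.toReal_pos (hg.leftVec_ne_zero hc hD hi) (hg.leftVec_ne_top hc hD i),
      ENNReal.toReal_pos (hg.rightVec_ne_zero hc hD hi) (hg.rightVec_ne_top hc hD i)⟩
  · filter_upwards [hall] with ω hg
    have hg0 : GoodPoint S p D L ω := hg 0
    have hg1 : GoodPoint S p D L (S.θ ω) := hg 1
    have hentry : ∀ i j, entry p ω i j ≠ ⊤ := fun i j => ENNReal.ofReal_ne_top
    refine ⟨fun j _ => ?_, fun i _ => ?_, ?_⟩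
    · rw [← ENNReal.toReal_mul, ← GoodPoint.left_eigen hc hD hg0 hg1 j,
        ENNReal.tsum_toReal_eq fun i => ENNReal.mul_ne_top (hg0.leftVec_ne_top hc hD i) (hentry i j)]
      simp only [ENNReal.toReal_mul, toReal_entry hc]
    · rw [← ENNReal.toReal_mul, ← GoodPoint.right_eigen hc hD hg0 hg1 i,
        ENNReal.tsum_toReal_eq fun j => ENNReal.mul_ne_top (hentry i j) (hg1.rightVec_ne_top hc hD j)]
      simp only [ENNReal.toReal_mul, toReal_entry hc]
    · simp only [← ENNReal.toReal_mul]
      rw [← ENNReal.tsum_toReal_eq fun i => ENNReal.mul_ne_top (hg0.leftVec_ne_top hc hD i)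
        (hg0.rightVec_ne_top hc hD i), hg0.tsum_leftVec_mul_rightVec hc hD, ENNReal.toReal_one]
  · filter_upwards [hall] with ω hg i _
    exact tendsto_rank_one hc hD hg i

end RandomTMC
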